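/- arXiv:2512.13181 — 7 statements merged into one kernel-verified Lean document; each statement's English description precedes it below -/
import Mathlib

section
/- Let d ≥ 2 be an integer, m ≥ 2 a real number, f : ℝ^d → ℝ a C² weight, and let v : ℝ^d → ℝ be a positive C³ solution of the v-equation 𝓛v = P := (1/v)·((m/2)|∇v|² + c_m). Assume that W_f[v] := ((m−d)/m²)(𝓛v)² + (2/m)(𝓛v)(∇f·∇v) + Hess f[∇v, ∇v] ≥ 0 at every point. Then for all real t ≥ 1/2, all real θ ≥ 2, and all non-negative continuously differentiable ψ : ℝ^d → ℝ with compact support, one has (t/2 − 1/4)² · ∫_{ℝ^d} e^{−f} P^{t−2} |∇P|² v^{2−m} ψ^θ dx ≤ θ² · ∫_{ℝ^d} e^{−f} P^t v^{2−m} |∇ψ|² ψ^{θ−2} dx. [Euclidean-base instance of Proposition 5.5.] -/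
open Real MeasureTheory Filter
open scoped RealInnerProductSpace

/-- Euclidean Laplacian: trace of the second derivative. -/
noncomputable def lapl {d : ℕ} (u : EuclideanSpace ℝ (Fin d) → ℝ)
    (x : EuclideanSpace ℝ (Fin d)) : ℝ :=
  ∑ i : Fin d, iteratedFDeriv ℝ 2 u x ![EuclideanSpace.single i 1, EuclideanSpace.single i 1]

/-- The constant c_m: 2/(m−2) for m > 2 and 1/2 for m = 2. -/
noncomputable def cm (m : ℝ) : ℝ := if m = 2 then 1/2 else 2/(m-2)

noncomputable section
namespace KeyProp
abbrev E (d : ℕ) := EuclideanSpace ℝ (Fin d)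

/-- Partial derivative. -/
def D {d : ℕ} (i : Fin d) (u : E d → ℝ) (x : E d) : ℝ :=
  fderiv ℝ u x (EuclideanSpace.single i 1)

variable {d : ℕ}

lemma D_mul (i : Fin d) {u w : E d → ℝ} {x : E d} (hu : DifferentiableAt ℝ u x)
    (hw : DifferentiableAt ℝ w x) :
    D i (fun y => u y * w y) x = u x * D i w x + D i u x * w x := by
  unfold D
  rw [fderiv_fun_mul hu hw]
  simp; ring

lemma D_sub (i : Fin d) {u w : E d → ℝ} {x : E d} (hu : DifferentiableAt ℝ u x)
    (hw : DifferentiableAt ℝ w x) :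
    D i (fun y => u y - w y) x = D i u x - D i w x := by
  unfold D
  rw [fderiv_fun_sub hu hw]
  simp

lemma D_add (i : Fin d) {u w : E d → ℝ} {x : E d} (hu : DifferentiableAt ℝ u x)
    (hw : DifferentiableAt ℝ w x) :
    D i (fun y => u y + w y) x = D i u x + D i w x := by
  unfold D
  rw [fderiv_fun_add hu hw]
  simp

lemma D_affine (i : Fin d) {u : E d → ℝ} {x : E d} (a c : ℝ) (hu : DifferentiableAt ℝ u x) :
    D i (fun y => a * u y + c) x = a * D i u x := by
  unfold D
  rw [fderiv_add_const, fderiv_const_mul hu]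
  simp

lemma D_sum (i : Fin d) {u : Fin d → E d → ℝ} {x : E d}
    (hu : ∀ j, DifferentiableAt ℝ (u j) x) :
    D i (fun y => ∑ j, u j y) x = ∑ j, D i (u j) x := by
  unfold D
  rw [fderiv_fun_sum (fun j _ => hu j)]
  simp

lemma D_rpow (i : Fin d) {u : E d → ℝ} {x : E d} (p : ℝ) (hu : DifferentiableAt ℝ u x)
    (h : u x ≠ 0 ∨ 1 ≤ p) :
    D i (fun y => u y ^ p) x = p * u x ^ (p - 1) * D i u x := by
  unfold D
  rw [(hu.hasFDerivAt.rpow_const h).fderiv]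
  simp

lemma D_exp_neg (i : Fin d) {u : E d → ℝ} {x : E d} (hu : DifferentiableAt ℝ u x) :
    D i (fun y => Real.exp (- u y)) x = - Real.exp (- u x) * D i u x := by
  unfold D
  rw [(hu.hasFDerivAt.fun_neg.exp).fderiv]
  simp

lemma contDiff_D (i : Fin d) {u : E d → ℝ} {n k : ℕ} (hu : ContDiff ℝ n u) (h : k + 1 ≤ n) :
    ContDiff ℝ k (D i u) := by
  unfold D
  exact (hu.fderiv_right (by exact_mod_cast h)).clm_apply contDiff_const

lemma D_comm (i j : Fin d) {u : E d → ℝ} (hu : ContDiff ℝ 2 u) (x : E d) :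
    D i (D j u) x = D j (D i u) x := by
  have h1 : Differentiable ℝ (fderiv ℝ u) :=
    (hu.fderiv_right (m := 1) (by norm_num)).differentiable (by norm_num)
  have h2 : ∀ i j : Fin d, D i (D j u) x =
      fderiv ℝ (fderiv ℝ u) x (EuclideanSpace.single i 1) (EuclideanSpace.single j 1) := by
    intro i j
    unfold D
    rw [fderiv_clm_apply (h1 x) (by fun_prop)]
    simp
  rw [h2, h2]
  exact (hu.contDiffAt.isSymmSndFDerivAt (by simp)) _ _

lemma iter_eq {u : E d → ℝ} (hu : ContDiff ℝ 2 u) (x : E d) (a : E d) :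
    iteratedFDeriv ℝ 2 u x ![a, a] = ∑ i, ∑ j, a i * a j * D i (D j u) x := by
  have h1 : Differentiable ℝ (fderiv ℝ u) :=
    (hu.fderiv_right (m := 1) (by norm_num)).differentiable (by norm_num)
  have h2 : ∀ i j : Fin d, D i (D j u) x =
      fderiv ℝ (fderiv ℝ u) x (EuclideanSpace.single i 1) (EuclideanSpace.single j 1) := by
    intro i j
    unfold D
    rw [fderiv_clm_apply (h1 x) (by fun_prop)]
    simp
  simp only [h2]
  rw [iteratedFDeriv_two_apply]
  simp only [Matrix.cons_val_zero, Matrix.cons_val_one]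
  have ha : a = ∑ i, a i • EuclideanSpace.single i (1:ℝ) := by
    ext k
    simp [Finset.sum_apply, Pi.single_apply]
  conv_lhs => rw [ha]
  simp [map_sum, Finset.mul_sum]
  rw [Finset.sum_comm]
  refine Finset.sum_congr rfl fun i _ => Finset.sum_congr rfl fun j _ => ?_
  ring

lemma lapl_eq {u : E d → ℝ} (hu : ContDiff ℝ 2 u) (x : E d) :
    lapl u x = ∑ i, D i (D i u) x := by
  unfold lapl
  refine Finset.sum_congr rfl fun i _ => ?_
  rw [iter_eq hu, Finset.sum_eq_single i, Finset.sum_eq_single i]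
  · simp
  · intro b _ hb
    simp [hb]
  · simp
  · intro b _ hb
    simp [hb]
  · simp

lemma grad_apply (u : E d → ℝ) (x : E d) (i : Fin d) : gradient u x i = D i u x := by
  have : ⟪gradient u x, EuclideanSpace.single i (1:ℝ)⟫ = D i u x := by
    unfold D gradient
    simp
  rw [← this, EuclideanSpace.inner_single_right]
  simp

lemma grad_inner (u w : E d → ℝ) (x : E d) :
    ⟪gradient u x, gradient w x⟫ = ∑ i, D i u x * D i w x := by
  rw [PiLp.inner_apply]
  simp [grad_apply, mul_comm]

lemma grad_norm (u : E d → ℝ) (x : E d) :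
    ‖gradient u x‖ ^ 2 = ∑ i, D i u x ^ 2 := by
  rw [EuclideanSpace.norm_sq_eq]
  simp [grad_apply]

lemma cm_pos {m : ℝ} (hm : 2 ≤ m) : 0 < cm m := by
  unfold cm
  split_ifs with h
  · norm_num
  · have : 2 < m := lt_of_le_of_ne hm (Ne.symm h)
    have : 0 < m - 2 := by linarith
    positivity

/-- pointwise algebra -/
lemma pointwise_alg (m V P c LP a : ℝ) (hm : 2 ≤ m) (hV : 0 < V) (hc : 0 < c)
    (p g w : Fin d → ℝ) (H K : Fin d → Fin d → ℝ)
    (h0 : P * V = m / 2 * ∑ j, w j ^ 2 + c)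
    (h1 : ∀ i, p i * V + P * w i = m * ∑ j, w j * H i j)
    (h2 : V * LP + 2 * ∑ i, p i * w i + P * ∑ i, H i i
      = m * (∑ i, ∑ j, H i j ^ 2) + m * (∑ j, w j * p j)
        + m * (∑ i, ∑ j, w i * w j * K i j) + V * (∑ i, g i * p i) + P * a)
    (h3 : (∑ i, H i i) - a = P)
    (hW : 0 ≤ ((m - (d : ℝ)) / m ^ 2) * P ^ 2 + (2 / m) * P * a
      + ∑ i, ∑ j, w i * w j * K i j) :
    (∑ i, p i ^ 2) / (2 * P) ≤ LP - (∑ i, g i * p i) + (2 - m) * V⁻¹ * ∑ i, w i * p i := by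
  have hm0 : 0 < m := by linarith
  have hw0 : 0 ≤ ∑ j, w j ^ 2 := Finset.sum_nonneg fun i _ => sq_nonneg _
  have hPV : 0 < P * V := by rw [h0]; positivity
  have hP : 0 < P := pos_of_mul_pos_left hPV hV.le
  set A : Fin d → Fin d → ℝ := fun i j => H i j - if i = j then P / m else 0 with hA
  have hA2 : ∑ i, ∑ j, A i j ^ 2 =
      (∑ i, ∑ j, H i j ^ 2) - 2 * (P / m) * (∑ i, H i i) + d * (P / m) ^ 2 := by
    have : ∀ i j, A i j ^ 2 = H i j ^ 2 + (if i = j then (-2 * (P / m) * H i j + (P / m) ^ 2) else 0) := by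
      intro i j
      simp only [hA]
      split_ifs <;> ring
    simp only [this, Finset.sum_add_distrib, Finset.sum_ite_eq, Finset.mem_univ, if_true,
      ← Finset.mul_sum, Finset.sum_const, Finset.card_univ, Fintype.card_fin, nsmul_eq_mul]
    ring
  have hAw : ∀ i, V * p i = m * ∑ j, w j * A i j := by
    intro i
    have : ∑ j, w j * A i j = (∑ j, w j * H i j) - w i * (P / m) := by
      simp only [hA, mul_sub, Finset.sum_sub_distrib, mul_ite, mul_zero, Finset.sum_ite_eq,
        Finset.mem_univ, if_true]
    rw [this, mul_sub, ← h1]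
    field_simp
    ring
  have hCS : V ^ 2 * ∑ i, p i ^ 2 ≤ m ^ 2 * ((∑ j, w j ^ 2) * ∑ i, ∑ j, A i j ^ 2) := by
    rw [Finset.mul_sum, Finset.mul_sum, Finset.mul_sum]
    refine Finset.sum_le_sum fun i _ => ?_
    rw [← mul_pow, hAw, mul_pow]
    exact mul_le_mul_of_nonneg_left (Finset.sum_mul_sq_le_sq_mul_sq _ _ _) (by positivity)
  set S := ∑ i, ∑ j, A i j ^ 2 with hS
  have hS0 : 0 ≤ S := Finset.sum_nonneg fun i _ => Finset.sum_nonneg fun j _ => sq_nonneg _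
  set X := ∑ i, p i ^ 2 with hX
  have hX2 : V * X ≤ 2 * m * P * S := by
    have : V * (V * X) ≤ V * (2 * m * P * S) := by
      have h5 : m * ∑ j, w j ^ 2 ≤ 2 * (P * V) := by rw [h0]; linarith
      have := mul_le_mul_of_nonneg_right h5 (mul_nonneg hm0.le hS0)
      nlinarith
    exact le_of_mul_le_mul_left this hV
  have hcomm : ∑ j, w j * p j = ∑ j, p j * w j := by simp [mul_comm]
  set Z := ∑ j, p j * w j
  set F := ∑ i, g i * p i
  set T := ∑ i, H i i
  set HH := ∑ i, ∑ j, H i j ^ 2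
  set KK := ∑ i, ∑ j, w i * w j * K i j
  rw [hcomm] at h2 ⊢
  have hT : T = P + a := by linarith
  have hk : m * S ≤ V * (LP - F) + (2 - m) * Z := by
    have h6 : V * (LP - F) + (2 - m) * Z = m * HH - P ^ 2 + m * KK := by
      rw [hT] at h2; linarith
    rw [h6, hA2, hT]
    have h7 := mul_nonneg hm0.le hW
    have h8 : m * ((m - (d : ℝ)) / m ^ 2 * P ^ 2 + 2 / m * P * a + KK)
      = (m * HH - P ^ 2 + m * KK) - m * (HH - 2 * (P / m) * (P + a) + d * (P / m) ^ 2) := by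
      field_simp
      ring
    linarith
  have h9 : LP - F + (2 - m) * V⁻¹ * Z = (V * (LP - F) + (2 - m) * Z) / V := by
    field_simp
  rw [h9, div_le_div_iff₀ (by positivity) hV]
  nlinarith [mul_le_mul_of_nonneg_left hk (by positivity : 0 ≤ 2 * P)]

lemma key_pointwise (m : ℝ) (hm : 2 ≤ m) (f v P : E d → ℝ)
    (hf : ContDiff ℝ 2 f) (hv : ContDiff ℝ 3 v) (hvpos : ∀ x, 0 < v x)
    (hPc : ContDiff ℝ 2 P)
    (hP : ∀ x, P x * v x = (m / 2) * ∑ j, D j v x * D j v x + cm m)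
    (hveq : ∀ x, P x = ∑ i, D i (D i v) x - ∑ i, D i f x * D i v x)
    (hW : ∀ x, 0 ≤ ((m - (d : ℝ)) / m ^ 2) * P x ^ 2
        + (2 / m) * P x * (∑ i, D i f x * D i v x)
        + ∑ i, ∑ j, D i v x * D j v x * D i (D j f) x) (x : E d) :
    (∑ i, D i P x ^ 2) / (2 * P x) ≤ (∑ i, D i (D i P) x) - (∑ i, D i f x * D i P x)
      + (2 - m) * (v x)⁻¹ * ∑ i, D i v x * D i P x := by
  have hv2 : ContDiff ℝ 2 v := hv.of_le (by norm_num)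
  have hDv : ∀ i, ContDiff ℝ 2 (D i v) := fun i => contDiff_D (n := 3) (k := 2) i hv (by norm_num)
  have hDDv : ∀ i j, ContDiff ℝ 1 (D i (D j v)) := fun i j =>
    contDiff_D (n := 2) (k := 1) i (hDv j) (by norm_num)
  have hDP : ∀ i, ContDiff ℝ 1 (D i P) := fun i => contDiff_D (n := 2) (k := 1) i hPc (by norm_num)
  have hDf : ∀ i, ContDiff ℝ 1 (D i f) := fun i => contDiff_D (n := 2) (k := 1) i hf (by norm_num)
  have dv : Differentiable ℝ v := hv.differentiable (by norm_num)
  have dP : Differentiable ℝ P := hPc.differentiable (by norm_num)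
  have dDv : ∀ i, Differentiable ℝ (D i v) := fun i => (hDv i).differentiable (by norm_num)
  have dDDv : ∀ i j, Differentiable ℝ (D i (D j v)) :=
    fun i j => (hDDv i j).differentiable (by norm_num)
  have dDP : ∀ i, Differentiable ℝ (D i P) := fun i => (hDP i).differentiable (by norm_num)
  have dDf : ∀ i, Differentiable ℝ (D i f) := fun i => (hDf i).differentiable (by norm_num)
  -- first derivative of the definition of P
  have h1 : ∀ i y, D i P y * v y + P y * D i v y = m * ∑ j, D j v y * D i (D j v) y := by
    intro i y
    have e : (fun y => P y * v y) = fun y => (m / 2) * (∑ j, D j v y * D j v y) + cm m := funext hP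
    have e2 := congrArg (fun u => D i u y) e
    rw [D_mul i (dP y) (dv y), D_affine i _ _ (by fun_prop),
      D_sum i (u := fun j y => D j v y * D j v y) (fun j => by fun_prop)] at e2
    have e3 : ∑ j, D i (fun y => D j v y * D j v y) y = 2 * ∑ j, D j v y * D i (D j v) y := by
      rw [Finset.mul_sum]
      refine Finset.sum_congr rfl fun j _ => ?_
      rw [D_mul i (dDv j y) (dDv j y)]; ring
    rw [e3] at e2
    linarith
  -- second derivative
  have h2 : ∀ i, D i (D i P) x * v x + 2 * (D i P x * D i v x) + P x * D i (D i v) x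
      = m * ∑ j, (D i (D j v) x ^ 2 + D j v x * D i (D i (D j v)) x) := by
    intro i
    have e : (fun y => D i P y * v y + P y * D i v y)
      = fun y => m * (∑ j, D j v y * D i (D j v) y) + 0 := by
      funext y; rw [h1, add_zero]
    have e2 := congrArg (fun u => D i u x) e
    have dd := dDP i
    have dd2 := dDv i
    rw [D_add i (by fun_prop) (by fun_prop), D_mul i (dDP i x) (dv x), D_mul i (dP x) (dDv i x),
      D_affine i _ _ (by
        refine DifferentiableAt.fun_sum fun j _ => ?_
        exact (dDv j x).mul (dDDv i j x)),
      D_sum i (u := fun j y => D j v y * D i (D j v) y)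
        (fun j => (dDv j x).mul (dDDv i j x))] at e2
    have e3 : ∑ j, D i (fun y => D j v y * D i (D j v) y) x
        = ∑ j, (D i (D j v) x ^ 2 + D j v x * D i (D i (D j v)) x) := by
      refine Finset.sum_congr rfl fun j _ => ?_
      rw [D_mul i (dDv j x) (dDDv i j x)]; ring
    rw [e3] at e2
    linarith
  -- derivative of the equation
  have h3 : ∀ j, D j P x = ∑ i, D i (D i (D j v)) x
      - ∑ i, (D i f x * D i (D j v) x + D i v x * D j (D i f) x) := by
    intro j
    have e : P = fun y => (∑ i, D i (D i v) y) - ∑ i, D i f y * D i v y := funext hveq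
    have e2 := congrArg (fun u => D j u x) e
    rw [e2, D_sub j
      (DifferentiableAt.fun_sum fun i _ => dDDv i i x)
      (DifferentiableAt.fun_sum fun i _ => (dDf i x).fun_mul (dDv i x)),
      D_sum j (u := fun i y => D i (D i v) y) (fun i => dDDv i i x),
      D_sum j (u := fun i y => D i f y * D i v y) (fun i => (dDf i x).fun_mul (dDv i x))]
    congr 1
    · refine Finset.sum_congr rfl fun i _ => ?_
      rw [D_comm j i (hDv i)]
      have : D j (D i v) = D i (D j v) := funext fun y => D_comm j i hv2 y
      rw [this]
    · refine Finset.sum_congr rfl fun i _ => ?_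
      rw [D_mul j (dDf i x) (dDv i x), D_comm j i hv2]; ring
  refine pointwise_alg m (v x) (P x) (cm m) (∑ i, D i (D i P) x) (∑ i, D i f x * D i v x) hm
    (hvpos x) (cm_pos hm) (fun i => D i P x) (fun i => D i f x) (fun i => D i v x)
    (fun i j => D i (D j v) x) (fun i j => D i (D j f) x) ?_ (fun i => h1 i x) ?_
    (hveq x).symm (hW x)
  · rw [hP]; simp only [pow_two]
  · have s2 := Finset.sum_congr (rfl : (Finset.univ : Finset (Fin d)) = _) fun i _ => h2 i
    simp only [Finset.sum_add_distrib, ← Finset.mul_sum, ← Finset.sum_mul] at s2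
    have s3 : ∑ i, ∑ j, D j v x * D i (D i (D j v)) x
        = ∑ j, D j v x * (D j P x
          + ∑ i, (D i f x * D i (D j v) x + D i v x * D j (D i f) x)) := by
      rw [Finset.sum_comm]
      refine Finset.sum_congr rfl fun j _ => ?_
      rw [← Finset.mul_sum, h3]; ring
    have s4 : ∑ j, D j v x * (D j P x
          + ∑ i, (D i f x * D i (D j v) x + D i v x * D j (D i f) x))
        = (∑ j, D j v x * D j P x) + (∑ i, D i f x * ∑ j, D j v x * D i (D j v) x)
          + ∑ i, ∑ j, D i v x * D j v x * D i (D j f) x := by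
      simp only [mul_add, Finset.sum_add_distrib, Finset.mul_sum]
      rw [← add_assoc]
      congr 1
      · congr 1
        rw [Finset.sum_comm]
        refine Finset.sum_congr rfl fun j _ => Finset.sum_congr rfl fun i _ => ?_
        ring
      · refine Finset.sum_congr rfl fun j _ => Finset.sum_congr rfl fun i _ => ?_
        ring
    have s5 : m * ∑ i, D i f x * ∑ j, D j v x * D i (D j v) x
        = v x * (∑ i, D i f x * D i P x) + P x * ∑ i, D i f x * D i v x := by
      rw [Finset.mul_sum, Finset.mul_sum, Finset.mul_sum, ← Finset.sum_add_distrib]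
      refine Finset.sum_congr rfl fun i _ => ?_
      have := h1 i x
      linear_combination (-D i f x) * this
    rw [s3, s4] at s2
    linear_combination s2 + s5

lemma cs_D (i : Fin d) {u : E d → ℝ} (hu : HasCompactSupport u) : HasCompactSupport (D i u) := by
  unfold D
  exact hu.fderiv_apply (𝕜 := ℝ) _

lemma ibp (i : Fin d) {u w : E d → ℝ} (hu : ContDiff ℝ 1 u) (hw : ContDiff ℝ 1 w)
    (hc : HasCompactSupport u) :
    Integrable (fun x => u x * D i w x + D i u x * w x) ∧
    ∫ x, (u x * D i w x + D i u x * w x) = 0 := by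
  have cu : Continuous (D i u) :=
    (contDiff_D (n := 1) (k := 0) i hu (by norm_num)).continuous
  have cw : Continuous (D i w) :=
    (contDiff_D (n := 1) (k := 0) i hw (by norm_num)).continuous
  have i1 : Integrable (fun x => u x * D i w x) :=
    (hu.continuous.mul cw).integrable_of_hasCompactSupport hc.mul_right
  have i2 : Integrable (fun x => D i u x * w x) :=
    (cu.mul hw.continuous).integrable_of_hasCompactSupport (cs_D i hc).mul_right
  have i3 : Integrable (fun x => u x * w x) :=
    (hu.continuous.mul hw.continuous).integrable_of_hasCompactSupport hc.mul_right
  refine ⟨i1.add i2, ?_⟩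
  rw [integral_add i1 i2]
  have := integral_mul_fderiv_eq_neg_fderiv_mul_of_integrable (μ := volume) i2 i1 i3
    (fun x _ => hu.differentiable (by norm_num) x) (fun x _ => hw.differentiable (by norm_num) x)
  unfold D at *
  rw [this]; ring

end KeyProp
end

open KeyProp in
/-- Euclidean-base instance of Proposition 5.5: the integral inequality for positive
solutions of the v-equation under the pointwise condition W_f[v] ≥ 0. -/
theorem integral_key_proposition
    (d : ℕ) (hd : 2 ≤ d) (m : ℝ) (hm : 2 ≤ m)
    (f v P : EuclideanSpace ℝ (Fin d) → ℝ)
    (hf : ContDiff ℝ 2 f) (hv : ContDiff ℝ 3 v) (hvpos : ∀ x, 0 < v x)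
    (hP : ∀ x, P x = (1 / v x) * ((m / 2) * ‖gradient v x‖ ^ 2 + cm m))
    (hveq : ∀ x, lapl v x - ⟪gradient f x, gradient v x⟫ = P x)
    (hW : ∀ x, 0 ≤ ((m - (d : ℝ)) / m ^ 2) * (lapl v x - ⟪gradient f x, gradient v x⟫) ^ 2
        + (2 / m) * (lapl v x - ⟪gradient f x, gradient v x⟫) * ⟪gradient f x, gradient v x⟫
        + iteratedFDeriv ℝ 2 f x ![gradient v x, gradient v x]) :
    ∀ t θ : ℝ, 1/2 ≤ t → 2 ≤ θ →
      ∀ ψ : EuclideanSpace ℝ (Fin d) → ℝ,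
        ContDiff ℝ 1 ψ → HasCompactSupport ψ → (∀ x, 0 ≤ ψ x) →
        (t/2 - 1/4) ^ 2 *
            (∫ x, Real.exp (-f x) * P x ^ (t - 2) * ‖gradient P x‖ ^ 2
              * v x ^ (2 - m) * ψ x ^ θ)
          ≤ θ ^ 2 * (∫ x, Real.exp (-f x) * P x ^ t * v x ^ (2 - m)
              * ‖gradient ψ x‖ ^ 2 * ψ x ^ (θ - 2)) := by
  intro t θ ht hθ ψ hψ hψc hψ0
  have hf1 : ContDiff ℝ 1 f := hf.of_le (by norm_num)
  have hv1 : ContDiff ℝ 1 v := hv.of_le (by norm_num)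
  have hv2 : ContDiff ℝ 2 v := hv.of_le (by norm_num)
  have hDv : ∀ i, ContDiff ℝ 2 (D i v) := fun i => contDiff_D (n := 3) (k := 2) i hv (by norm_num)
  have hPpos : ∀ x, 0 < P x := by
    intro x
    rw [hP]
    have := hvpos x
    have := cm_pos hm
    positivity
  have hPc : ContDiff ℝ 2 P := by
    have : P = fun x => (1 / v x) * ((m / 2) * (∑ j, D j v x ^ 2) + cm m) := by
      funext x; rw [hP, grad_norm]
    rw [this]
    refine ContDiff.mul (contDiff_const.div hv2 fun x => (hvpos x).ne') ?_
    exact (contDiff_const.mul (ContDiff.sum fun j _ => (hDv j).pow 2)).add contDiff_const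
  have hP1 : ContDiff ℝ 1 P := hPc.of_le (by norm_num)
  have hDP : ∀ i, ContDiff ℝ 1 (D i P) := fun i => contDiff_D (n := 2) (k := 1) i hPc (by norm_num)
  have key := key_pointwise m hm f v P hf hv hvpos hPc
    (fun x => by
      rw [hP, grad_norm]
      have := (hvpos x).ne'
      field_simp)
    (fun x => by rw [← hveq, lapl_eq hv2, grad_inner])
    (fun x => by
      have := hW x
      rw [hveq, grad_inner, iter_eq hf] at this
      simpa only [grad_apply] using this)
  -- the test function and the vector field
  have hφ : ContDiff ℝ 1 (fun x => ψ x ^ θ * P x ^ (t - 1)) :=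
    (ContDiff.rpow_const_of_le (m := 1) hψ (by norm_num; linarith)).mul
      (hP1.rpow_const_of_ne fun x => (hPpos x).ne')
  have hφc : HasCompactSupport (fun x => ψ x ^ θ * P x ^ (t - 1)) := by
    have : HasCompactSupport (fun x => ψ x ^ θ) :=
      hψc.comp_left (g := fun y : ℝ => y ^ θ) (Real.zero_rpow (by linarith))
    exact this.mul_right
  have hG : ∀ i, ContDiff ℝ 1 (fun x => Real.exp (-f x) * v x ^ (2 - m) * D i P x) := fun i =>
    (hf1.neg.exp.mul (hv1.rpow_const_of_ne fun x => (hvpos x).ne')).mul (hDP i)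
  have IB := fun i => ibp i hφ (hG i) hφc
  -- the two integrands
  have cP : ∀ p : ℝ, Continuous fun x => P x ^ p := fun p =>
    hP1.continuous.rpow_const fun x => Or.inl (hPpos x).ne'
  have cv : ∀ p : ℝ, Continuous fun x => v x ^ p := fun p =>
    hv1.continuous.rpow_const fun x => Or.inl (hvpos x).ne'
  have cf : Continuous fun x => Real.exp (-f x) := hf1.continuous.neg.rexp
  have cψ : ∀ p : ℝ, 0 ≤ p → Continuous fun x => ψ x ^ p := fun p hp =>
    hψ.continuous.rpow_const fun x => Or.inr hp
  have cgP : Continuous fun x => ‖gradient P x‖ ^ 2 := by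
    simp only [grad_norm]
    exact continuous_finsetSum _ fun i _ => (hDP i).continuous.pow 2
  have cgψ : Continuous fun x => ‖gradient ψ x‖ ^ 2 := by
    simp only [grad_norm]
    exact continuous_finsetSum _ fun i _ =>
      (contDiff_D (n := 1) (k := 0) i hψ (by norm_num)).continuous.pow 2
  have scψ : HasCompactSupport (fun x => ψ x ^ θ) :=
    hψc.comp_left (g := fun y : ℝ => y ^ θ) (Real.zero_rpow (by linarith))
  have scgψ : HasCompactSupport (fun x => ‖gradient ψ x‖ ^ 2) := by
    refine (hψc.fderiv (𝕜 := ℝ)).mono ?_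
    intro x hx
    simp only [Function.mem_support] at hx ⊢
    intro h
    apply hx
    simp [gradient, h]
  have iA : Integrable (fun x => Real.exp (-f x) * P x ^ (t - 2) * ‖gradient P x‖ ^ 2
              * v x ^ (2 - m) * ψ x ^ θ) :=
    ((((cf.mul (cP _)).mul cgP).mul (cv _)).mul
      (cψ _ (by linarith))).integrable_of_hasCompactSupport scψ.mul_left
  have iB : Integrable (fun x => Real.exp (-f x) * P x ^ t * v x ^ (2 - m)
              * ‖gradient ψ x‖ ^ 2 * ψ x ^ (θ - 2)) :=
    ((((cf.mul (cP _)).mul (cv _)).mul cgψ).mul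
      (cψ _ (by linarith))).integrable_of_hasCompactSupport scgψ.mul_left.mul_right
  set s : ℝ := t - 1 / 2 with hs
  have hs0 : 0 ≤ s := by linarith
  have hpt : ∀ x, s ^ 2 * (Real.exp (-f x) * P x ^ (t - 2) * ‖gradient P x‖ ^ 2
              * v x ^ (2 - m) * ψ x ^ θ)
      - θ ^ 2 * (Real.exp (-f x) * P x ^ t * v x ^ (2 - m)
              * ‖gradient ψ x‖ ^ 2 * ψ x ^ (θ - 2))
      ≤ 2 * s * ∑ i, ((ψ x ^ θ * P x ^ (t - 1))
          * D i (fun x => Real.exp (-f x) * v x ^ (2 - m) * D i P x) x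
        + D i (fun x => ψ x ^ θ * P x ^ (t - 1)) x
          * (Real.exp (-f x) * v x ^ (2 - m) * D i P x)) := by
    intro x
    have dfx := hf1.differentiable (by norm_num) x
    have dvx := hv1.differentiable (by norm_num) x
    have dPx := hP1.differentiable (by norm_num) x
    have dψx := hψ.differentiable (by norm_num) x
    have dDPx := fun i => (hDP i).differentiable (by norm_num) x
    have d1 : DifferentiableAt ℝ (fun x => Real.exp (-f x)) x := dfx.fun_neg.exp
    have d2 : DifferentiableAt ℝ (fun x => v x ^ (2 - m)) x :=
      dvx.rpow_const (Or.inl (hvpos x).ne')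
    have d3 : DifferentiableAt ℝ (fun x => P x ^ (t - 1)) x :=
      dPx.rpow_const (Or.inl (hPpos x).ne')
    have d4 : DifferentiableAt ℝ (fun x => ψ x ^ θ) x :=
      dψx.rpow_const (Or.inr (by linarith))
    have e1 : ∀ i, D i (fun x => Real.exp (-f x) * v x ^ (2 - m) * D i P x) x
        = Real.exp (-f x) * v x ^ (2 - m) * (D i (D i P) x - D i f x * D i P x
          + (2 - m) * (v x)⁻¹ * (D i v x * D i P x)) := by
      intro i
      rw [D_mul i (d1.fun_mul d2) (dDPx i), D_mul i d1 d2, D_exp_neg i dfx,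
        D_rpow i _ dvx (Or.inl (hvpos x).ne'), Real.rpow_sub_one (hvpos x).ne']
      ring
    have e2 : ∀ i, D i (fun x => ψ x ^ θ * P x ^ (t - 1)) x
        = (t - 1) * ψ x ^ θ * P x ^ (t - 2) * D i P x
          + θ * ψ x ^ (θ - 1) * P x ^ (t - 1) * D i ψ x := by
      intro i
      rw [D_mul i d4 d3, D_rpow i _ dPx (Or.inl (hPpos x).ne'),
        D_rpow i _ dψx (Or.inr (by linarith)), show t - 1 - 1 = t - 2 by ring]
      ring
    simp only [e1, e2, grad_norm]
    have hPx := hPpos x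
    have r1 : P x ^ (t - 1) = P x ^ (t - 2) * P x := by
      rw [← Real.rpow_add_one hPx.ne']; congr 1; ring
    have r2 : P x ^ t = P x ^ (t - 2) * P x ^ 2 := by
      rw [← Real.rpow_natCast (P x) 2, ← Real.rpow_add hPx]; congr 1; push_cast; ring
    have r3 : ψ x ^ (θ - 1) = ψ x ^ (θ - 2) * ψ x := by
      conv_rhs => rw [← Real.rpow_one (ψ x), Real.rpow_one (ψ x)]
      rw [show θ - 1 = (θ - 2) + 1 by ring,
        Real.rpow_add_of_nonneg (hψ0 x) (by linarith) (by norm_num), Real.rpow_one]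
    have r4 : ψ x ^ θ = ψ x ^ (θ - 2) * ψ x ^ 2 := by
      rw [← Real.rpow_natCast (ψ x) 2, ← Real.rpow_add_of_nonneg (hψ0 x) (by linarith)
        (by norm_num)]
      congr 1; push_cast; ring
    have hk := key x
    have hα : 0 < P x ^ (t - 2) := Real.rpow_pos_of_pos hPx _
    have hβ : 0 ≤ ψ x ^ (θ - 2) := Real.rpow_nonneg (hψ0 x) _
    have hw : 0 < Real.exp (-f x) * v x ^ (2 - m) :=
      mul_pos (Real.exp_pos _) (Real.rpow_pos_of_pos (hvpos x) _)
    rw [r1, r2, r3, r4]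
    generalize P x ^ (t - 2) = α at *
    generalize ψ x ^ (θ - 2) = β at *
    have hQ : ∑ i, (β * ψ x ^ 2 * (α * P x) * (Real.exp (-f x) * v x ^ (2 - m) *
            (D i (D i P) x - D i f x * D i P x + (2 - m) * (v x)⁻¹ * (D i v x * D i P x)))
          + ((t - 1) * (β * ψ x ^ 2) * α * D i P x + θ * (β * ψ x) * (α * P x) * D i ψ x)
            * (Real.exp (-f x) * v x ^ (2 - m) * D i P x))
        = (Real.exp (-f x) * v x ^ (2 - m)) * α * β *
          (ψ x ^ 2 * P x * ((∑ i, D i (D i P) x) - (∑ i, D i f x * D i P x)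
            + (2 - m) * (v x)⁻¹ * ∑ i, D i v x * D i P x)
          + (t - 1) * ψ x ^ 2 * (∑ i, D i P x ^ 2)
          + θ * ψ x * P x * (∑ i, D i P x * D i ψ x)) := by
      simp only [Finset.mul_sum, ← Finset.sum_sub_distrib, ← Finset.sum_add_distrib]
      refine Finset.sum_congr rfl fun i _ => ?_
      ring
    rw [hQ]
    have hsq : 0 ≤ s ^ 2 * ψ x ^ 2 * (∑ i, D i P x ^ 2)
        + 2 * s * θ * P x * ψ x * (∑ i, D i P x * D i ψ x)
        + θ ^ 2 * P x ^ 2 * ∑ i, D i ψ x ^ 2 := by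
      have : s ^ 2 * ψ x ^ 2 * (∑ i, D i P x ^ 2)
        + 2 * s * θ * P x * ψ x * (∑ i, D i P x * D i ψ x)
        + θ ^ 2 * P x ^ 2 * ∑ i, D i ψ x ^ 2
        = ∑ i, (s * ψ x * D i P x + θ * P x * D i ψ x) ^ 2 := by
        simp only [Finset.mul_sum, ← Finset.sum_add_distrib]
        refine Finset.sum_congr rfl fun i _ => ?_
        ring
      rw [this]
      exact Finset.sum_nonneg fun i _ => sq_nonneg _
    have hk2 : ψ x ^ 2 * ((∑ i, D i P x ^ 2) / 2) ≤ ψ x ^ 2 * P x *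
        ((∑ i, D i (D i P) x) - (∑ i, D i f x * D i P x)
            + (2 - m) * (v x)⁻¹ * ∑ i, D i v x * D i P x) := by
      have := mul_le_mul_of_nonneg_left hk (by positivity : 0 ≤ ψ x ^ 2 * P x)
      refine le_trans (le_of_eq ?_) this
      field_simp
    generalize ((∑ i, D i (D i P) x) - (∑ i, D i f x * D i P x)
            + (2 - m) * (v x)⁻¹ * ∑ i, D i v x * D i P x) = L at *
    generalize (∑ i, D i P x ^ 2) = X at *
    generalize (∑ i, D i P x * D i ψ x) = Z at *
    generalize (∑ i, D i ψ x ^ 2) = Y at *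
    have hC : 0 ≤ (Real.exp (-f x) * v x ^ (2 - m)) * α * β :=
      mul_nonneg (mul_nonneg hw.le hα.le) hβ
    have h5 : s ^ 2 * ψ x ^ 2 * X - θ ^ 2 * P x ^ 2 * Y
        ≤ 2 * s * (ψ x ^ 2 * P x * L + (t - 1) * ψ x ^ 2 * X + θ * ψ x * P x * Z) := by
      have h6 := mul_le_mul_of_nonneg_left hk2 (by linarith : 0 ≤ 2 * s)
      have ht' : t - 1 = s - 1 / 2 := by rw [hs]; ring
      rw [ht']
      nlinarith
    have h7 := mul_le_mul_of_nonneg_left h5 hC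
    refine le_trans (le_of_eq ?_) (h7.trans (le_of_eq ?_)) <;> ring
  have hint := integral_mono ((iA.const_mul (s ^ 2)).sub (iB.const_mul (θ ^ 2)))
    ((integrable_finsetSum _ fun i _ => (IB i).1).const_mul (2 * s)) hpt
  rw [integral_const_mul, integral_finsetSum _ (fun i _ => (IB i).1),
    Finset.sum_eq_zero (fun i _ => (IB i).2), mul_zero] at hint
  simp only [Pi.sub_apply] at hint
  rw [integral_sub (iA.const_mul (s ^ 2)) (iB.const_mul (θ ^ 2)), integral_const_mul,
    integral_const_mul] at hint
  have hA0 : 0 ≤ ∫ x, Real.exp (-f x) * P x ^ (t - 2) * ‖gradient P x‖ ^ 2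
              * v x ^ (2 - m) * ψ x ^ θ := by
    refine integral_nonneg fun x => ?_
    have h1 := (Real.rpow_pos_of_pos (hPpos x) (t - 2)).le
    have h2 := (Real.rpow_pos_of_pos (hvpos x) (2 - m)).le
    have h3 := Real.rpow_nonneg (hψ0 x) θ
    simp only [Pi.zero_apply]
    positivity
  have h4 : (t / 2 - 1 / 4) ^ 2 = s ^ 2 / 4 := by rw [hs]; ring
  rw [h4]
  have := mul_nonneg (sq_nonneg s) hA0
  linarith
end

section
/- (Derivative of the Pohozaev function; corrected form of equation (deriv-p-1).) Fix an integer d ≥ 3 and a real p > 1. Let ψ : [0,∞) → ℝ be smooth with ψ(0) = 0, ψ'(0) = 1 and ψ' > 0 on (0,∞), let f : [0,∞) → ℝ be smooth, and set w(r) = e^{−f(r)} ψ(r)^{d−1}. Let R > 0, and let u ∈ C²((0,R)) satisfy u''(r) + ((d−1)ψ'(r)/ψ(r) − f'(r))u'(r) + u(r)^p = 0 on (0,R). Define E_u(r) = u'(r)²/2 + u(r)^{p+1}/(p+1) and P_u(r) = (∫₀^r w(s) ds)·E_u(r) + (1/(p+1))·w(r) u(r) u'(r). Then for all r ∈ (0,R):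 P_u'(r) = [ (1/2 + 1/(p+1))·w(r) − (w'(r)/w(r))·∫₀^r w(s) ds ] · u'(r)². -/
open Real

/-- Derivative of the Pohozaev function (corrected form of (deriv-p-1)) for solutions
of the radial weighted Lane-Emden ODE. -/
theorem pohozaev_derivative
    (d : ℕ) (hd : 3 ≤ d) (p : ℝ) (hp : 1 < p)
    (ψ f : ℝ → ℝ) (hψ : ContDiff ℝ (⊤ : ℕ∞) ψ) (hψ0 : ψ 0 = 0)
    (hψ'0 : deriv ψ 0 = 1) (hψ' : ∀ r : ℝ, 0 < r → 0 < deriv ψ r)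
    (hf : ContDiff ℝ (⊤ : ℕ∞) f)
    (w : ℝ → ℝ) (hw : ∀ r, w r = Real.exp (-f r) * ψ r ^ (d - 1))
    (R : ℝ) (hR : 0 < R) (u : ℝ → ℝ)
    (hu : ContDiffOn ℝ 2 u (Set.Ioo 0 R))
    (hode : ∀ r ∈ Set.Ioo (0 : ℝ) R,
        deriv (deriv u) r
          + (((d : ℝ) - 1) * deriv ψ r / ψ r - deriv f r) * deriv u r + u r ^ p = 0)
    (Eu Pu : ℝ → ℝ)
    (hEu : ∀ r, Eu r = deriv u r ^ 2 / 2 + u r ^ (p + 1) / (p + 1))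
    (hPu : ∀ r, Pu r = (∫ s in (0:ℝ)..r, w s) * Eu r
        + (1 / (p + 1)) * w r * u r * deriv u r) :
    ∀ r ∈ Set.Ioo (0 : ℝ) R,
      deriv Pu r
        = ((1/2 + 1/(p+1)) * w r - (deriv w r / w r) * ∫ s in (0:ℝ)..r, w s)
            * deriv u r ^ 2 := by
  intro r hr
  have hr0 : 0 < r := hr.1
  have hψd : Differentiable ℝ ψ := hψ.differentiable (by simp)
  have hfd : Differentiable ℝ f := hf.differentiable (by simp)
  -- positivity of ψ and w
  have hψpos : 0 < ψ r := by
    have hmono : StrictMonoOn ψ (Set.Ici 0) := by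
      apply strictMonoOn_of_deriv_pos (convex_Ici 0) hψ.continuous.continuousOn
      intro x hx
      rw [interior_Ici] at hx
      exact hψ' x hx
    have h := hmono (Set.self_mem_Ici) (Set.mem_Ici.2 hr0.le) hr0
    rwa [hψ0] at h
  have hwr : 0 < w r := by rw [hw]; positivity
  have hwfun : w = fun r => Real.exp (-f r) * ψ r ^ (d - 1) := funext hw
  have hwc : Continuous w := by
    rw [hwfun]
    exact (Real.continuous_exp.comp hf.continuous.neg).mul (hψ.continuous.pow _)
  -- the derivative of w
  have hwd : HasDerivAt w
      (w r * (((d : ℝ) - 1) * deriv ψ r / ψ r - deriv f r)) r := by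
    obtain ⟨k, rfl⟩ : ∃ k, d = k + 2 := ⟨d - 2, by omega⟩
    have h1 := ((hfd r).hasDerivAt.neg.exp).mul ((hψd r).hasDerivAt.pow (k + 1))
    have h2 := h1.congr_of_eventuallyEq (f₁ := w) (Filter.Eventually.of_forall hw)
    refine h2.congr_deriv ?_
    rw [hw]
    simp only [Pi.neg_apply, Pi.pow_apply, show k + 2 - 1 = k + 1 from rfl, Nat.add_sub_cancel]
    push_cast
    field_simp
    ring
  -- the derivatives of u
  have hIoo : Set.Ioo 0 R ∈ nhds r := isOpen_Ioo.mem_nhds hr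
  have hu1 : HasDerivAt u (deriv u r) r :=
    ((hu.contDiffAt hIoo).differentiableAt (by norm_num)).hasDerivAt
  have hu2 : HasDerivAt (deriv u) (deriv (deriv u) r) r := by
    have h : ContDiffOn ℝ 1 (deriv u) (Set.Ioo 0 R) :=
      hu.deriv_of_isOpen isOpen_Ioo (by norm_num)
    exact ((h.contDiffAt hIoo).differentiableAt (by norm_num)).hasDerivAt
  have hup : HasDerivAt (fun x => u x ^ (p + 1)) (deriv u r * (p + 1) * u r ^ p) r := by
    have h := hu1.rpow_const (p := p + 1) (Or.inr (by linarith))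
    simpa using h
  have hupow : u r ^ (p + 1) = u r ^ p * u r := by
    by_cases h0 : u r = 0
    · rw [h0, Real.zero_rpow (by linarith)]; simp
    · exact Real.rpow_add_one h0 p
  have hI : HasDerivAt (fun x => ∫ s in (0:ℝ)..x, w s) (w r) r :=
    intervalIntegral.integral_hasDerivAt_right (hwc.intervalIntegrable _ _)
      (hwc.stronglyMeasurableAtFilter _ _) hwc.continuousAt
  have hE : HasDerivAt Eu (deriv u r * deriv (deriv u) r + deriv u r * u r ^ p) r := by
    rw [funext hEu]
    refine (((hu2.fun_pow 2).div_const 2).add (hup.div_const (p + 1))).congr_deriv ?_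
    have : p + 1 ≠ 0 := by linarith
    field_simp
    norm_num
    ring
  have hP := (hI.mul hE).add (((hwd.const_mul (1 / (p + 1))).mul hu1).mul hu2)
  have hP' := hP.congr_of_eventuallyEq (f₁ := Pu) (Filter.Eventually.of_forall hPu)
  rw [hP'.deriv, hwd.deriv, hEu, hupow, mul_div_cancel_left₀ _ hwr.ne']
  have hode' := hode r hr
  generalize ((d : ℝ) - 1) * deriv ψ r / ψ r - deriv f r = a at *
  have h2 : deriv (deriv u) r = -(a * deriv u r) - u r ^ p := by linarith
  simp only [h2, Pi.mul_apply]
  ring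
end

section
/- (Sign of the Pohozaev coefficient under the curvature-type condition.) Fix an integer d ≥ 3 and a real p ≥ (d+2)/(d−2). Let ψ : [0,∞) → ℝ be smooth with ψ(0) = 0, ψ'(0) = 1 and ψ' > 0 on (0,∞), and let f : [0,∞) → ℝ be smooth with f'(0) = 0. Set w(r) = e^{−f(r)} ψ(r)^{d−1}. Assume that for all r > 0: (a) f'(r) < (d−1)ψ'(r)/ψ(r) (equivalently w'(r) > 0), and (b) −(d−1)ψ''(r)/ψ(r) + f''(r) + 2ψ'(r)f'(r)/ψ(r) − f'(r)²/(d−1) ≤ 0. Then for every r > 0: w'(r)·∫₀^r w(s) ds ≥ ((d−1)/d)·w(r)², and consequently K(r) := (1/2 + 1/(p+1))·w(r) − (w'(r)/w(r))·∫₀^r w(s) ds ≤ 0. -/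
open Real

/-- Sign of the Pohozaev coefficient under the curvature-type condition
(infty-exist-cond): w'·∫₀^r w ≥ ((d−1)/d)·w², hence K(r) ≤ 0 for p ≥ (d+2)/(d−2). -/
theorem pohozaev_coefficient_nonpositive
    (d : ℕ) (hd : 3 ≤ d) (p : ℝ) (hp : ((d : ℝ) + 2) / ((d : ℝ) - 2) ≤ p)
    (ψ f : ℝ → ℝ) (hψ : ContDiff ℝ (⊤ : ℕ∞) ψ) (hψ0 : ψ 0 = 0)
    (hψ'0 : deriv ψ 0 = 1) (hψ' : ∀ r : ℝ, 0 < r → 0 < deriv ψ r)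
    (hf : ContDiff ℝ (⊤ : ℕ∞) f) (hf'0 : deriv f 0 = 0)
    (w : ℝ → ℝ) (hw : ∀ r, w r = Real.exp (-f r) * ψ r ^ (d - 1))
    (ha : ∀ r : ℝ, 0 < r → deriv f r < ((d : ℝ) - 1) * deriv ψ r / ψ r)
    (hb : ∀ r : ℝ, 0 < r →
        -((d : ℝ) - 1) * deriv (deriv ψ) r / ψ r + deriv (deriv f) r
          + 2 * deriv ψ r * deriv f r / ψ r - deriv f r ^ 2 / ((d : ℝ) - 1) ≤ 0) :
    ∀ r : ℝ, 0 < r →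
      (((d : ℝ) - 1) / (d : ℝ) * w r ^ 2 ≤ deriv w r * ∫ s in (0:ℝ)..r, w s) ∧
      (1/2 + 1/(p+1)) * w r - (deriv w r / w r) * (∫ s in (0:ℝ)..r, w s) ≤ 0 := by
  obtain ⟨n, rfl⟩ : ∃ n, d = n + 1 := ⟨d - 1, by omega⟩
  have hn2 : 2 ≤ n := by omega
  have hn : (2 : ℝ) ≤ n := by exact_mod_cast hn2
  have hn0 : (n : ℝ) ≠ 0 := by positivity
  simp only [Nat.add_sub_cancel] at hw
  push_cast at *
  simp only [add_sub_cancel_right] at *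
  have hψd : ∀ x, HasDerivAt ψ (deriv ψ x) x := fun x =>
    (hψ.differentiable (by simp) x).hasDerivAt
  have hfd : ∀ x, HasDerivAt f (deriv f x) x := fun x =>
    (hf.differentiable (by simp) x).hasDerivAt
  have hψ1 : ContDiff ℝ (⊤ : ℕ∞) (deriv ψ) := (contDiff_infty_iff_deriv.1 hψ).2
  have hf1 : ContDiff ℝ (⊤ : ℕ∞) (deriv f) := (contDiff_infty_iff_deriv.1 hf).2
  have hψdd : ∀ x, HasDerivAt (deriv ψ) (deriv (deriv ψ) x) x := fun x =>
    (hψ1.differentiable (by simp) x).hasDerivAt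
  have hfdd : ∀ x, HasDerivAt (deriv f) (deriv (deriv f) x) x := fun x =>
    (hf1.differentiable (by simp) x).hasDerivAt
  have hψpos : ∀ x, 0 < x → 0 < ψ x := by
    intro x hx
    have hm : StrictMonoOn ψ (Set.Ici 0) := by
      apply strictMonoOn_of_deriv_pos (convex_Ici 0) hψ.continuous.continuousOn
      intro y hy
      rw [interior_Ici] at hy
      exact hψ' y hy
    have := hm (Set.self_mem_Ici) (Set.mem_Ici.2 hx.le) hx
    rwa [hψ0] at this
  -- the reduced function
  obtain ⟨E, hE⟩ : ∃ E : ℝ → ℝ, ∀ x, E x = Real.exp (-f x / n) := ⟨_, fun _ => rfl⟩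
  have hEpos : ∀ x, 0 < E x := fun x => by rw [hE]; exact Real.exp_pos _
  have hEd : ∀ x, HasDerivAt E (E x * (-deriv f x / n)) x := by
    intro x
    have h := (((hfd x).neg).div_const (n : ℝ)).exp
    have e : E = fun x => Real.exp (-f x / n) := funext hE
    rw [e]
    exact h
  obtain ⟨φ, hφ⟩ : ∃ φ : ℝ → ℝ, ∀ x, φ x = E x * ψ x := ⟨_, fun _ => rfl⟩
  obtain ⟨φ1, hφ1⟩ : ∃ φ1 : ℝ → ℝ, ∀ x, φ1 x = E x * (deriv ψ x - ψ x * deriv f x / n) :=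
    ⟨_, fun _ => rfl⟩
  obtain ⟨φ2, hφ2⟩ : ∃ φ2 : ℝ → ℝ, ∀ x, φ2 x = E x * (deriv (deriv ψ) x
      - 2 * deriv ψ x * deriv f x / n - ψ x * deriv (deriv f) x / n
      + ψ x * deriv f x ^ 2 / n ^ 2) := ⟨_, fun _ => rfl⟩
  have hφd : ∀ x, HasDerivAt φ (φ1 x) x := by
    intro x
    rw [show φ = fun x => E x * ψ x from funext hφ, hφ1]
    refine ((hEd x).mul (hψd x)).congr_deriv ?_
    ring
  have hφ1d : ∀ x, HasDerivAt φ1 (φ2 x) x := by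
    intro x
    rw [show φ1 = fun x => E x * (deriv ψ x - ψ x * deriv f x / n) from funext hφ1, hφ2]
    refine ((hEd x).mul ((hψdd x).sub (((hψd x).mul (hfdd x)).div_const (n : ℝ)))).congr_deriv ?_
    simp only [Pi.mul_apply, Pi.sub_apply]
    field_simp
    ring
  have hφpos : ∀ x, 0 < x → 0 < φ x := fun x hx => by
    rw [hφ]; exact mul_pos (hEpos x) (hψpos x hx)
  have hφ2nn : ∀ x, 0 < x → 0 ≤ φ2 x := by
    intro x hx
    rw [hφ2]
    refine mul_nonneg (hEpos x).le ?_
    have h := hb x hx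
    have hp0 := hψpos x hx
    have h2 := mul_nonneg (div_pos hp0 (by positivity : (0:ℝ) < n)).le (neg_nonneg.2 h)
    refine h2.trans (le_of_eq ?_)
    field_simp
    ring
  have hwφ : ∀ x, w x = φ x ^ n := by
    intro x
    rw [hw, hφ, mul_pow, hE, ← Real.exp_nat_mul]
    congr 2
    field_simp
  have hφc : Continuous φ := continuous_iff_continuousAt.2 fun x => (hφd x).continuousAt
  have hwe : w = fun x => φ x ^ n := funext hwφ
  have hwc : Continuous w := by rw [hwe]; exact hφc.pow n
  have hwd : ∀ x, deriv w x = n * φ x ^ (n - 1) * φ1 x := by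
    intro x
    rw [hwe]
    exact ((hφd x).pow n).deriv
  have hId : ∀ x, HasDerivAt (fun x => ∫ s in (0:ℝ)..x, w s) (w x) x := fun x =>
    intervalIntegral.integral_hasDerivAt_right (hwc.intervalIntegrable _ _)
      (hwc.stronglyMeasurableAtFilter _ _) hwc.continuousAt
  have hInn : ∀ x, 0 < x → 0 ≤ ∫ s in (0:ℝ)..x, w s := by
    intro x hx
    apply intervalIntegral.integral_nonneg hx.le
    intro u hu
    rcases hu.1.eq_or_lt with h | h
    · rw [hwφ, ← h, hφ, hψ0, mul_zero, zero_pow (by omega)]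
    · rw [hwφ]; exact (pow_pos (hφpos u h) n).le
  have hGd : ∀ x, HasDerivAt (fun x => φ1 x * (∫ s in (0:ℝ)..x, w s) - φ x ^ (n+1) / ((n:ℝ)+1))
      (φ2 x * ∫ s in (0:ℝ)..x, w s) x := by
    intro x
    refine (((hφ1d x).mul (hId x)).sub (((hφd x).pow (n+1)).div_const ((n:ℝ)+1))).congr_deriv ?_
    rw [hwφ x]
    have : (n:ℝ) + 1 ≠ 0 := by positivity
    push_cast
    field_simp
    ring
  have hmono : MonotoneOn (fun x => φ1 x * (∫ s in (0:ℝ)..x, w s) - φ x ^ (n+1) / ((n:ℝ)+1))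
      (Set.Ici 0) := by
    apply monotoneOn_of_deriv_nonneg (convex_Ici 0)
    · exact fun x _ => (hGd x).continuousAt.continuousWithinAt
    · exact fun x _ => (hGd x).differentiableAt.differentiableWithinAt
    · intro x hx
      rw [interior_Ici] at hx
      rw [(hGd x).deriv]
      exact mul_nonneg (hφ2nn x hx) (hInn x hx)
  intro r hr
  have hG := hmono Set.self_mem_Ici (Set.mem_Ici.2 hr.le) hr.le
  have hφ0 : φ 0 = 0 := by rw [hφ, hψ0, mul_zero]
  simp only [hφ0, intervalIntegral.integral_same, mul_zero, zero_pow (Nat.succ_ne_zero n),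
    zero_div, sub_zero] at hG
  have hn1 : (0:ℝ) < (n:ℝ) + 1 := by positivity
  have hwpos : 0 < w r := by rw [hwφ]; exact pow_pos (hφpos r hr) n
  have main : (n:ℝ) / ((n:ℝ)+1) * w r ^ 2 ≤ deriv w r * ∫ s in (0:ℝ)..r, w s := by
    rw [hwd]
    have hc : 0 ≤ (n:ℝ) * φ r ^ (n-1) := mul_nonneg (by positivity) (pow_pos (hφpos r hr) _).le
    have h3 := mul_nonneg hc hG
    have h4 : φ r ^ (n-1) * φ r ^ (n+1) = w r ^ 2 := by
      rw [hwφ, ← pow_add, ← pow_mul]; congr 1; omega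
    have h5 : (n:ℝ) / ((n:ℝ)+1) * w r ^ 2
        = (n:ℝ) * φ r ^ (n-1) * (φ r ^ (n+1) / ((n:ℝ)+1)) := by
      rw [← h4]; ring
    rw [h5]
    linarith
  refine ⟨main, ?_⟩
  have hcoef : 1/2 + 1/(p+1) ≤ (n:ℝ)/((n:ℝ)+1) := by
    have hm : (0:ℝ) < (n:ℝ) + 1 - 2 := by linarith
    have hp1 : 2*((n:ℝ)+1)/((n:ℝ)+1-2) ≤ p + 1 := by
      have : 2*((n:ℝ)+1)/((n:ℝ)+1-2) = ((n:ℝ)+1+2)/((n:ℝ)+1-2) + 1 := by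
        field_simp; ring
      linarith
    have h6 := one_div_le_one_div_of_le (by positivity) hp1
    have h7 : 1/2 + 1/(2*((n:ℝ)+1)/((n:ℝ)+1-2)) = (n:ℝ)/((n:ℝ)+1) := by
      field_simp; ring
    linarith
  have h8 : (n:ℝ)/((n:ℝ)+1) * w r ≤ deriv w r / w r * ∫ s in (0:ℝ)..r, w s := by
    rw [div_mul_eq_mul_div (deriv w r), le_div_iff₀ hwpos]
    calc _ = (n:ℝ) / ((n:ℝ)+1) * w r ^ 2 := by ring
      _ ≤ _ := main
  have h9 := mul_le_mul_of_nonneg_right hcoef hwpos.le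
  linarith
end

section
/- (Global existence of positive radial solutions; analytic core of Theorem 1.2.) Fix an integer d ≥ 3, a real p ≥ (d+2)/(d−2), and ℓ > 0. Let ψ : [0,∞) → ℝ be smooth with ψ(0) = 0, ψ'(0) = 1 and ψ' > 0 on (0,∞), and let f : [0,∞) → ℝ be smooth with f'(0) = 0, such that for all r > 0: (a) f'(r) < (d−1)ψ'(r)/ψ(r), and (b) −(d−1)ψ''(r)/ψ(r) + f''(r) + 2ψ'(r)f'(r)/ψ(r) − f'(r)²/(d−1) ≤ 0. Then there exists a function u ∈ C²([0,∞)) with u > 0 on [0,∞), u(0) = ℓ, u'(0) = 0, u'(r) < 0 for all r > 0, satisfying u''(r) + ((d−1)ψ'(r)/ψ(r) − f'(r))·u'(r) + u(r)^p = 0 for all r > 0. -/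
open Real

/-- averaged right-hand side -/
noncomputable def QQ (A h : ℝ → ℝ) (s : ℝ) : ℝ := (∫ t in (0:ℝ)..s, A t * h t) / A s

lemma QQ_zero (A h : ℝ → ℝ) : QQ A h 0 = 0 := by simp [QQ]

lemma QQ_bound {A h b : ℝ → ℝ} (hA : Continuous A) (hpos : ∀ r, 0 < r → 0 < A r)
    (hmono : MonotoneOn A (Set.Ici 0)) (hh : Continuous h) (hb : Continuous b)
    {s : ℝ} (hs : 0 ≤ s) (hhb : ∀ t ∈ Set.Icc 0 s, |h t| ≤ b t) :
    |QQ A h s| ≤ ∫ t in (0:ℝ)..s, b t := by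
  rcases hs.eq_or_lt with rfl | hs'
  · simp [QQ]
  have hAs := hpos s hs'
  rw [QQ, abs_div, abs_of_pos hAs, div_le_iff₀ hAs]
  have h1 : |∫ t in (0:ℝ)..s, A t * h t| ≤ ∫ t in (0:ℝ)..s, A s * b t := by
    refine (intervalIntegral.abs_integral_le_integral_abs hs).trans ?_
    apply intervalIntegral.integral_mono_on hs
    · exact ((hA.mul hh).abs).intervalIntegrable _ _
    · exact (continuous_const.mul hb).intervalIntegrable _ _
    · intro t ht
      have hA0 : 0 ≤ A t := by
        rcases ht.1.eq_or_lt with h0 | h0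
        · rw [← h0]
          have : Filter.Tendsto A (nhdsWithin 0 (Set.Ioi 0)) (nhds (A 0)) :=
            hA.continuousAt.tendsto.mono_left nhdsWithin_le_nhds
          exact ge_of_tendsto this (by
            filter_upwards [self_mem_nhdsWithin] with x hx using (hpos x hx).le)
        · exact (hpos t h0).le
      rw [abs_mul, abs_of_nonneg hA0]
      exact mul_le_mul (hmono ht.1 hs ht.2) (hhb t ht) (abs_nonneg _) hAs.le
  rw [intervalIntegral.integral_const_mul] at h1
  linarith

lemma QQ_sub {A h h' : ℝ → ℝ} (hA : Continuous A) (hh : Continuous h) (hh' : Continuous h')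
    (s : ℝ) : QQ A h s - QQ A h' s = QQ A (fun t => h t - h' t) s := by
  unfold QQ
  rw [← sub_div, ← intervalIntegral.integral_sub]
  · congr 2; ext t; ring
  · exact (hA.mul hh).intervalIntegrable _ _
  · exact (hA.mul hh').intervalIntegrable _ _

lemma QQ_cont {A h : ℝ → ℝ} (hA : Continuous A) (hpos : ∀ r, 0 < r → 0 < A r)
    (hmono : MonotoneOn A (Set.Ici 0)) (hh : Continuous h) :
    Continuous (fun s => QQ A h (max s 0)) := by
  have hI : Continuous (fun s => ∫ t in (0:ℝ)..s, A t * h t) :=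
    intervalIntegral.continuous_primitive (fun a b => (hA.mul hh).intervalIntegrable _ _) _
  have hB : Continuous (fun s => ∫ t in (0:ℝ)..s, |h t|) :=
    intervalIntegral.continuous_primitive (fun a b => (hh.abs).intervalIntegrable _ _) _
  rw [continuous_iff_continuousAt]
  intro s
  rcases le_or_gt s 0 with hs | hs
  · have hm : Continuous (fun s : ℝ => max s 0) := by fun_prop
    have key : Filter.Tendsto (fun s => ∫ t in (0:ℝ)..(max s 0), |h t|) (nhds s) (nhds 0) := by
      have := (hB.comp hm).continuousAt (x := s)
      simpa [ContinuousAt, hs, Function.comp_def] using this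
    rw [ContinuousAt, max_eq_right hs, QQ_zero]
    apply squeeze_zero_norm _ key
    intro x
    exact QQ_bound hA hpos hmono hh hh.abs (le_max_right _ _) (fun t _ => le_rfl)
  · have : ContinuousAt (QQ A h) s := hI.continuousAt.div hA.continuousAt (hpos s hs).ne'
    refine this.congr ?_
    filter_upwards [Ioi_mem_nhds hs] with x hx
    rw [max_eq_left (le_of_lt (Set.mem_Ioi.1 hx))]

lemma QQ_deriv {A h : ℝ → ℝ} {A' s : ℝ} (hA : Continuous A) (hh : Continuous h)
    (hs : 0 < A s) (hd : HasDerivAt A A' s) :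
    HasDerivAt (QQ A h) (h s - A' / A s * QQ A h s) s := by
  have h1 : HasDerivAt (fun s => ∫ t in (0:ℝ)..s, A t * h t) (A s * h s) s :=
    intervalIntegral.integral_hasDerivAt_right ((hA.mul hh).intervalIntegrable _ _)
      (hA.mul hh).stronglyMeasurable.stronglyMeasurableAtFilter (hA.mul hh).continuousAt
  refine (h1.div hd hs.ne').congr_deriv ?_
  unfold QQ
  field_simp

lemma exists_sol {A g : ℝ → ℝ} {L M ℓ : ℝ} (hA : Continuous A) (hpos : ∀ r, 0 < r → 0 < A r)
    (hmono : MonotoneOn A (Set.Ici 0)) (hL : 0 ≤ L) (hM : 0 ≤ M) (hg : Continuous g)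
    (hgM : ∀ x, |g x| ≤ M) (hgL : ∀ x y, |g x - g y| ≤ L * |x - y|) :
    ∃ u : ℝ → ℝ, u 0 = ℓ ∧ Continuous u ∧
      ∀ r, HasDerivAt u (-QQ A (fun t => g (u t)) (max r 0)) r := by
  set k : ℝ := L + 1 with hk
  have hk1 : 1 ≤ k := by linarith
  have hk0 : 0 < k := by linarith
  let H : (BoundedContinuousFunction ℝ ℝ) → ℝ → ℝ := fun w t => g (exp (k * |t|) * w t)
  have hH : ∀ w, Continuous (H w) := fun w => by
    have := w.continuous
    exact hg.comp (by fun_prop)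
  let I : (BoundedContinuousFunction ℝ ℝ) → ℝ → ℝ :=
    fun w r => ∫ s in (0:ℝ)..r, QQ A (H w) (max s 0)
  have hQc : ∀ w, Continuous (fun s => QQ A (H w) (max s 0)) :=
    fun w => QQ_cont hA hpos hmono (hH w)
  have hI : ∀ w, Continuous (I w) := fun w =>
    intervalIntegral.continuous_primitive (fun a b => (hQc w).intervalIntegrable _ _) _
  have hIneg : ∀ w r, r ≤ 0 → I w r = 0 := by
    intro w r hr
    have : I w r = ∫ s in (0:ℝ)..r, (0:ℝ) := by
      apply intervalIntegral.integral_congr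
      intro s hs
      rw [Set.uIcc_of_ge hr] at hs
      simp only [max_eq_right hs.2, QQ_zero]
    simpa using this
  have hIbd : ∀ w r, |I w r| ≤ M * r ^ 2 := by
    intro w r
    rcases le_or_gt r 0 with hr | hr
    · rw [hIneg w r hr]; simp; positivity
    · have := intervalIntegral.norm_integral_le_of_norm_le_const (a := 0) (b := r) (C := M * r)
        (f := fun s => QQ A (H w) (max s 0)) (by
          intro s hs
          rw [Set.uIoc_of_le hr.le] at hs
          rw [max_eq_left hs.1.le]
          have h2 := QQ_bound hA hpos hmono (hH w) (continuous_const (y := M)) hs.1.le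
            (fun t _ => hgM _)
          simp at h2
          rw [Real.norm_eq_abs]
          nlinarith [hs.2])
      rw [Real.norm_eq_abs, sub_zero, abs_of_pos hr] at this
      calc _ ≤ _ := this
        _ = _ := by ring
  have hcont : ∀ w, Continuous (fun r => exp (-(k * |r|)) * (ℓ - I w r)) := fun w => by
    have := hI w
    fun_prop
  let T : (BoundedContinuousFunction ℝ ℝ) → (BoundedContinuousFunction ℝ ℝ) := fun w =>
    BoundedContinuousFunction.ofNormedAddCommGroup
      (fun r => exp (-(k * |r|)) * (ℓ - I w r)) (hcont w) (|ℓ| + 2 * M) (by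
        intro r
        rw [norm_mul, Real.norm_eq_abs, Real.norm_eq_abs, abs_of_pos (exp_pos _), exp_neg,
          inv_mul_le_iff₀ (exp_pos _)]
        have h1 : |r| ≤ k * |r| := by nlinarith [abs_nonneg r]
        have h2 := Real.quadratic_le_exp_of_nonneg (abs_nonneg r)
        have h3 := Real.exp_le_exp.2 h1
        have h4 : |ℓ - I w r| ≤ |ℓ| + M * r ^ 2 := (abs_sub _ _).trans (by linarith [hIbd w r])
        rw [sq_abs] at h2
        have h5 : r ^ 2 ≤ 2 * exp (k * |r|) := by nlinarith [abs_nonneg r]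
        have h6 : 1 ≤ exp (k * |r|) := by nlinarith [abs_nonneg r, sq_nonneg r]
        nlinarith [abs_nonneg ℓ, mul_le_mul_of_nonneg_left h5 hM,
          mul_le_mul_of_nonneg_left h6 (abs_nonneg ℓ)])
  have hTapp : ∀ w r, T w r = exp (-(k * |r|)) * (ℓ - I w r) := fun w r => rfl
  have hexpint : ∀ s, ∫ t in (0:ℝ)..s, exp (k * t) ≤ exp (k * s) / k := by
    intro s
    have : ∫ t in (0:ℝ)..s, exp (k * t) = exp (k * s) / k - exp (k * 0) / k := by
      apply intervalIntegral.integral_eq_sub_of_hasDerivAt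
      · intro x _
        have := ((hasDerivAt_id x).const_mul k).exp.div_const k
        simp only [id] at this
        refine this.congr_deriv ?_
        field_simp
      · exact Continuous.intervalIntegrable (by fun_prop) _ _
    rw [this]
    have : 0 < exp (k * 0) / k := by positivity
    linarith
  have hdiff : ∀ w w' r, |I w r - I w' r| ≤ L * dist w w' * exp (k * |r|) / k ^ 2 := by
    intro w w' r
    rcases le_or_gt r 0 with hr | hr
    · rw [hIneg w r hr, hIneg w' r hr]; simp; positivity
    · rw [abs_of_pos hr]
      have e : I w r - I w' r = ∫ s in (0:ℝ)..r, (QQ A (H w) (max s 0) - QQ A (H w') (max s 0)) :=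
        (intervalIntegral.integral_sub ((hQc w).intervalIntegrable _ _)
          ((hQc w').intervalIntegrable _ _)).symm
      rw [e]
      refine (intervalIntegral.abs_integral_le_integral_abs hr.le).trans ?_
      have h1 : ∫ s in (0:ℝ)..r, |QQ A (H w) (max s 0) - QQ A (H w') (max s 0)|
          ≤ ∫ s in (0:ℝ)..r, (L * dist w w' / k) * exp (k * s) := by
        apply intervalIntegral.integral_mono_on hr.le
        · exact (((hQc w).sub (hQc w')).abs).intervalIntegrable _ _
        · exact Continuous.intervalIntegrable (by fun_prop) _ _
        · intro s hs
          rw [max_eq_left hs.1, QQ_sub hA (hH w) (hH w')]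
          have h2 := QQ_bound (b := fun t => (L * dist w w') * exp (k * t)) hA hpos hmono
            ((hH w).sub (hH w')) (by fun_prop) hs.1 (by
              intro t ht
              refine (hgL _ _).trans ?_
              rw [← mul_sub, abs_mul, abs_of_pos (exp_pos _), abs_of_nonneg ht.1]
              have h3 : |w t - w' t| ≤ dist w w' := by
                rw [← Real.dist_eq]; exact BoundedContinuousFunction.dist_coe_le_dist t
              calc L * (exp (k * t) * |w t - w' t|) ≤ L * (exp (k * t) * dist w w') := by gcongr
                _ = _ := by ring)
          refine h2.trans ?_
          rw [intervalIntegral.integral_const_mul]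
          calc _ ≤ L * dist w w' * (exp (k * s) / k) := by
                have := hexpint s
                gcongr
            _ = _ := by ring
      refine h1.trans ?_
      rw [intervalIntegral.integral_const_mul]
      calc _ ≤ L * dist w w' / k * (exp (k * r) / k) := by
            have := hexpint r
            gcongr
        _ = _ := by field_simp
  have hT : ContractingWith (1/2 : NNReal) T := by
    refine ⟨by rw [← NNReal.coe_lt_coe]; norm_num, LipschitzWith.of_dist_le_mul ?_⟩
    intro w w'
    rw [BoundedContinuousFunction.dist_le (by positivity)]
    intro r
    rw [hTapp, hTapp, Real.dist_eq, ← mul_sub, abs_mul, abs_of_pos (exp_pos _), exp_neg,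
      inv_mul_le_iff₀ (exp_pos _), sub_sub_sub_cancel_left, abs_sub_comm]
    refine (hdiff w w' r).trans ?_
    rw [div_le_iff₀ (by positivity)]
    push_cast
    have h1 : L ≤ 1 / 2 * k ^ 2 := by rw [hk]; nlinarith [sq_nonneg L]
    calc L * dist w w' * exp (k * |r|) ≤ (1 / 2 * k ^ 2) * dist w w' * exp (k * |r|) := by gcongr
      _ = _ := by ring
  obtain ⟨w, hw⟩ : ∃ w, T w = w := ⟨hT.fixedPoint, hT.fixedPoint_isFixedPt⟩
  have hu : ∀ r, exp (k * |r|) * w r = ℓ - I w r := by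
    intro r
    conv_lhs => rw [← hw]
    rw [hTapp, ← mul_assoc, ← exp_add]
    simp
  refine ⟨fun r => ℓ - I w r, ?_, ?_, ?_⟩
  · simp [hIneg w 0 le_rfl]
  · exact continuous_const.sub (hI w)
  · intro r
    have : (fun t => g (ℓ - I w t)) = H w := by
      ext t; simp only [H]; rw [hu]
    rw [this]
    apply HasDerivAt.const_sub
    exact intervalIntegral.integral_hasDerivAt_right ((hQc w).intervalIntegrable _ _)
      (hQc w).stronglyMeasurable.stronglyMeasurableAtFilter (hQc w).continuousAt

lemma g_props {p ℓ : ℝ} (hp : 1 < p) (hℓ : 0 < ℓ) :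
    Continuous (fun x : ℝ => (max 0 (min x ℓ)) ^ p) ∧
    (∀ x : ℝ, |(max 0 (min x ℓ)) ^ p| ≤ ℓ ^ p) ∧
    ∀ x y : ℝ, |(max 0 (min x ℓ)) ^ p - (max 0 (min y ℓ)) ^ p| ≤ (p * ℓ ^ (p - 1)) * |x - y| := by
  have hc : ∀ x : ℝ, max 0 (min x ℓ) ∈ Set.Icc 0 ℓ := fun x =>
    ⟨le_max_left _ _, max_le hℓ.le (min_le_right _ _)⟩
  refine ⟨?_, ?_, ?_⟩
  · have : Continuous (fun x : ℝ => max 0 (min x ℓ)) := by fun_prop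
    exact this.rpow_const (fun x => Or.inr (by linarith))
  · intro x
    rw [abs_of_nonneg (rpow_nonneg (hc x).1 _)]
    exact rpow_le_rpow (hc x).1 (hc x).2 (by linarith)
  · intro x y
    have h1 := (convex_Icc (0:ℝ) ℓ).norm_image_sub_le_of_norm_hasDerivWithin_le
      (f := fun x : ℝ => x ^ p) (f' := fun x => p * x ^ (p - 1)) (C := p * ℓ ^ (p - 1))
      (fun z hz => (Real.hasDerivAt_rpow_const (Or.inr hp.le)).hasDerivWithinAt)
      (fun z hz => by
        rw [Real.norm_eq_abs, abs_of_nonneg (mul_nonneg (by linarith) (rpow_nonneg hz.1 _))]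
        have := rpow_le_rpow hz.1 hz.2 (show 0 ≤ p - 1 by linarith)
        gcongr) (hc y) (hc x)
    rw [Real.norm_eq_abs, Real.norm_eq_abs] at h1
    refine h1.trans ?_
    have h2 : |max 0 (min x ℓ) - max 0 (min y ℓ)| ≤ |x - y| := by
      refine (abs_max_sub_max_le_max 0 _ 0 _).trans ?_
      rw [sub_self, abs_zero, max_eq_right (abs_nonneg _)]
      refine (abs_min_sub_min_le_max x ℓ y ℓ).trans ?_
      simp
    have : 0 ≤ p * ℓ ^ (p - 1) := by positivity
    gcongr

/-- Comparison coming from monotonicity of the derivative of `φ`. -/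
lemma vol_ineq (n : ℕ) {φ φ' : ℝ → ℝ} (hφ : ∀ r, HasDerivAt φ (φ' r) r)
    (hmono : MonotoneOn φ' (Set.Ici 0)) (hpos : ∀ r, 0 < r → 0 < φ r) (h0 : φ 0 = 0)
    {r : ℝ} (hr : 0 < r) :
    φ r ^ (n + 1) ≤ (n + 1) * φ' r * ∫ t in (0:ℝ)..r, φ t ^ n := by
  have hc : Continuous φ := continuous_iff_continuousAt.2 fun r => (hφ r).continuousAt
  have hG : ∀ s, HasDerivAt (fun s => ∫ t in (0:ℝ)..s, φ t ^ n) (φ s ^ n) s := fun s =>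
    intervalIntegral.integral_hasDerivAt_right ((hc.pow n).intervalIntegrable _ _)
      (hc.pow n).stronglyMeasurable.stronglyMeasurableAtFilter (hc.pow n).continuousAt
  let F : ℝ → ℝ := fun s => (n + 1) * φ' r * (∫ t in (0:ℝ)..s, φ t ^ n) - φ s ^ (n + 1)
  have hF : ∀ s, HasDerivAt F ((n + 1) * φ s ^ n * (φ' r - φ' s)) s := by
    intro s
    refine (((hG s).const_mul ((n + 1) * φ' r)).sub ((hφ s).pow (n + 1))).congr_deriv ?_
    push_cast
    ring
  have hm : MonotoneOn F (Set.Icc 0 r) := by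
    apply monotoneOn_of_hasDerivWithinAt_nonneg (convex_Icc 0 r)
      (fun s _ => (hF s).continuousAt.continuousWithinAt)
      (fun s _ => (hF s).hasDerivWithinAt)
    intro s hs
    rw [interior_Icc] at hs
    have h1 := hpos s hs.1
    have h2 := hmono (Set.mem_Ici.2 hs.1.le) (Set.mem_Ici.2 hr.le) hs.2.le
    have h3 : 0 ≤ φ' r - φ' s := by linarith
    positivity
  have := hm (Set.left_mem_Icc.2 hr.le) (Set.right_mem_Icc.2 hr.le) hr.le
  simp [F, h0] at this
  linarith

/-- Pohozaev: the solution cannot vanish. -/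
lemma pohozaev (n : ℕ) {p : ℝ} (hp1 : 1 < p) (hp : 1 / (p + 1) + 1 / 2 ≤ (n : ℝ) / (n + 1))
    {φ φ' : ℝ → ℝ} (hφ : ∀ r, HasDerivAt φ (φ' r) r)
    (hmono : MonotoneOn φ' (Set.Ici 0)) (hpos : ∀ r, 0 < r → 0 < φ r) (h0 : φ 0 = 0)
    {u q : ℝ → ℝ} {R : ℝ} (hR : 0 < R)
    (hqc : Continuous q) (hq0 : 0 < q R) (hu : ∀ r, HasDerivAt u (-q r) r) (hn : n ≠ 0)
    (hq : ∀ r ∈ Set.Ioo 0 R, HasDerivAt q (u r ^ p - n * φ' r / φ r * q r) r)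
    (hupos : ∀ r ∈ Set.Ioo 0 R, 0 < u r) (huR : u R = 0) : False := by
  have hc : Continuous φ := continuous_iff_continuousAt.2 fun r => (hφ r).continuousAt
  have huc : Continuous u := continuous_iff_continuousAt.2 fun r => (hu r).continuousAt
  have hG : ∀ s, HasDerivAt (fun s => ∫ t in (0:ℝ)..s, φ t ^ n) (φ s ^ n) s := fun s =>
    intervalIntegral.integral_hasDerivAt_right ((hc.pow n).intervalIntegrable _ _)
      (hc.pow n).stronglyMeasurable.stronglyMeasurableAtFilter (hc.pow n).continuousAt
  set G : ℝ → ℝ := fun s => ∫ t in (0:ℝ)..s, φ t ^ n with hGdef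
  have hGc : Continuous G := continuous_iff_continuousAt.2 fun r => (hG r).continuousAt
  have hupc : Continuous (fun r => u r ^ (p + 1)) :=
    huc.rpow_const (fun x => Or.inr (by linarith))
  let N : ℝ → ℝ := fun r => G r * (q r ^ 2 / 2 + u r ^ (p + 1) / (p + 1))
    - φ r ^ n * (u r * q r) / (p + 1)
  have hNc : Continuous N := by
    simp only [N]
    fun_prop
  have hN : ∀ r ∈ Set.Ioo 0 R, HasDerivAt N
      (q r ^ 2 * (φ r ^ n * (1 / (p + 1) + 1 / 2) - n * φ' r / φ r * G r)) r := by
    intro r hr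
    have hup : HasDerivAt (fun r => u r ^ (p + 1)) (-q r * (p + 1) * u r ^ (p + 1 - 1)) r :=
      (hu r).rpow_const (Or.inr (by linarith))
    have hφr := hpos r hr.1
    have hur := hupos r hr
    have hp0 : p + 1 ≠ 0 := by linarith
    refine (((hG r).mul ((((hq r hr).pow 2).div_const 2).add (hup.div_const (p + 1)))).sub
      ((((hφ r).pow n).mul ((hu r).mul (hq r hr))).div_const (p + 1))).congr_deriv ?_
    have e1 : u r ^ (p + 1) = u r ^ p * u r := by rw [rpow_add hur, rpow_one]
    have e2 : p + 1 - 1 = p := by ring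
    obtain ⟨m, rfl⟩ := Nat.exists_eq_succ_of_ne_zero hn
    simp only [Pi.pow_apply, Pi.add_apply, Pi.mul_apply, e2, Nat.succ_eq_add_one,
      Nat.add_sub_cancel, e1]
    push_cast
    field_simp
    ring
  have hm : AntitoneOn N (Set.Icc 0 R) := by
    apply antitoneOn_of_hasDerivWithinAt_nonpos (convex_Icc 0 R) hNc.continuousOn
      (f' := fun r => q r ^ 2 * (φ r ^ n * (1 / (p + 1) + 1 / 2) - n * φ' r / φ r * G r))
    · intro r hr
      rw [interior_Icc] at hr
      exact (hN r hr).hasDerivWithinAt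
    · intro r hr
      rw [interior_Icc] at hr
      have hφr := hpos r hr.1
      have h1 := vol_ineq n hφ hmono hpos h0 hr.1
      have h2 : φ r ^ n * ((n : ℝ) / (n + 1)) ≤ n * φ' r / φ r * G r := by
        have : φ r ^ n * ((n : ℝ) / (n + 1)) = φ r ^ (n + 1) * (n / ((n + 1) * φ r)) := by
          rw [pow_succ]; field_simp
        rw [this]
        calc _ ≤ ((n + 1) * φ' r * G r) * (n / ((n + 1) * φ r)) := by gcongr
          _ = _ := by field_simp
      have h3 : φ r ^ n * (1 / (p + 1) + 1 / 2) ≤ φ r ^ n * ((n : ℝ) / (n + 1)) := by gcongr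
      exact mul_nonpos_of_nonneg_of_nonpos (sq_nonneg _) (by linarith)
  have h1 := hm (Set.left_mem_Icc.2 hR.le) (Set.right_mem_Icc.2 hR.le) hR.le
  have hGR : 0 < G R := by
    apply intervalIntegral.intervalIntegral_pos_of_pos_on ((hc.pow n).intervalIntegrable _ _) _ hR
    intro x hx
    exact pow_pos (hpos x hx.1) n
  have hG0 : G 0 = 0 := by simp [hGdef]
  have e : (0:ℝ) ^ (p + 1) = 0 := zero_rpow (by linarith)
  simp [N, huR, hG0, h0, e, hn] at h1
  have : 0 < G R * (q R ^ 2 / 2) := by positivity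
  linarith

theorem core (n : ℕ) (hn : n ≠ 0) {p ℓ : ℝ} (hp1 : 1 < p)
    (hp : 1 / (p + 1) + 1 / 2 ≤ (n : ℝ) / (n + 1)) (hℓ : 0 < ℓ)
    {φ φ' : ℝ → ℝ} (hφ : ∀ r, HasDerivAt φ (φ' r) r) (hφ'c : Continuous φ')
    (hmono : MonotoneOn φ' (Set.Ici 0)) (hφ'0 : 0 < φ' 0) (h0 : φ 0 = 0) :
    ∃ u : ℝ → ℝ, ContDiffOn ℝ 2 u (Set.Ici 0) ∧
      (∀ r : ℝ, 0 ≤ r → 0 < u r) ∧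
      u 0 = ℓ ∧
      derivWithin u (Set.Ici 0) 0 = 0 ∧
      (∀ r : ℝ, 0 < r → deriv u r < 0) ∧
      (∀ r : ℝ, 0 < r →
        deriv (deriv u) r + n * φ' r / φ r * deriv u r + u r ^ p = 0) := by
  have hφ'pos : ∀ r, 0 ≤ r → 0 < φ' r := fun r hr =>
    hφ'0.trans_le (hmono (Set.mem_Ici.2 le_rfl) (Set.mem_Ici.2 hr) hr)
  have hc : Continuous φ := continuous_iff_continuousAt.2 fun r => (hφ r).continuousAt
  have hsm : StrictMonoOn φ (Set.Ici 0) := by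
    apply strictMonoOn_of_hasDerivWithinAt_pos (convex_Ici 0) hc.continuousOn
      (fun s _ => (hφ s).hasDerivWithinAt)
    intro s hs
    rw [interior_Ici] at hs
    exact hφ'pos s (le_of_lt hs)
  have hpos : ∀ r, 0 < r → 0 < φ r := by
    intro r hr
    have := hsm (Set.mem_Ici.2 le_rfl) (Set.mem_Ici.2 hr.le) hr
    rwa [h0] at this
  set A : ℝ → ℝ := fun r => φ r ^ n with hAdef
  have hAc : Continuous A := hc.pow n
  have hApos : ∀ r, 0 < r → 0 < A r := fun r hr => pow_pos (hpos r hr) n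
  have hAmono : MonotoneOn A (Set.Ici 0) := by
    intro x hx y hy hxy
    have h1 := hsm.monotoneOn hx hy hxy
    have h2 := hsm.monotoneOn (Set.mem_Ici.2 le_rfl) hx hx
    rw [h0] at h2
    exact pow_le_pow_left₀ h2 h1 n
  have hAd : ∀ r, 0 < r → HasDerivAt A (n * φ' r / φ r * A r) r := by
    intro r hr
    have := hpos r hr
    refine ((hφ r).pow n).congr_deriv ?_
    obtain ⟨m, rfl⟩ := Nat.exists_eq_succ_of_ne_zero hn
    simp only [hAdef, Nat.succ_eq_add_one, Nat.add_sub_cancel]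
    field_simp
    ring
  obtain ⟨hgc, hgM, hgL⟩ := g_props hp1 hℓ
  set g : ℝ → ℝ := fun x : ℝ => (max 0 (min x ℓ)) ^ p with hg
  have hg0 : ∀ x, 0 ≤ g x := fun x => rpow_nonneg (le_max_left _ _) _
  obtain ⟨u, hu0, huc, hu⟩ := exists_sol (ℓ := ℓ) hAc hApos hAmono
    (show 0 ≤ p * ℓ ^ (p - 1) by positivity) (show 0 ≤ ℓ ^ p by positivity) hgc hgM hgL
  have hguc : Continuous (fun t => g (u t)) := hgc.comp huc
  set q : ℝ → ℝ := fun r => QQ A (fun t => g (u t)) (max r 0) with hqdef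
  have hqc : Continuous q := QQ_cont hAc hApos hAmono hguc
  have hqd : ∀ r, 0 < r → HasDerivAt q (g (u r) - n * φ' r / φ r * q r) r := by
    intro r hr
    have h1 := QQ_deriv hAc hguc (hApos r hr) (hAd r hr)
    have e : q r = QQ A (fun t => g (u t)) r := by simp only [hqdef, max_eq_left hr.le]
    rw [mul_div_cancel_right₀ _ (hApos r hr).ne', ← e] at h1
    refine h1.congr_of_eventuallyEq ?_
    filter_upwards [Ioi_mem_nhds hr] with x hx
    simp only [hqdef, max_eq_left (le_of_lt (Set.mem_Ioi.1 hx))]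
  have hq0 : q 0 = 0 := by simp [hqdef, QQ_zero]
  -- positivity of q
  have hqpos : ∀ r, 0 < r → 0 < q r := by
    intro r hr
    have e : q r = (∫ t in (0:ℝ)..r, A t * g (u t)) / A r := by
      simp only [hqdef, max_eq_left hr.le, QQ]
    rw [e]
    apply div_pos _ (hApos r hr)
    have hev : ∀ᶠ t in nhdsWithin 0 (Set.Ioi 0), 0 < u t ∧ t < r := by
      apply nhdsWithin_le_nhds
      filter_upwards [huc.continuousAt.eventually (lt_mem_nhds (show 0 < u 0 by rw [hu0]; exact hℓ)),
        Iio_mem_nhds hr] with t h1 h2 using ⟨h1, h2⟩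
    obtain ⟨c, ⟨hc1, hc2⟩, hc0⟩ := (hev.and self_mem_nhdsWithin).exists
    apply intervalIntegral.integral_pos hr (hAc.mul hguc).continuousOn
    · intro x hx
      exact mul_nonneg (hApos x hx.1).le (hg0 _)
    · refine ⟨c, ⟨le_of_lt hc0, hc2.le⟩, mul_pos (hApos c hc0) ?_⟩
      exact rpow_pos_of_pos (lt_max_of_lt_right (lt_min hc1 hℓ)) _
  have hanti : StrictAntiOn u (Set.Ici 0) := by
    apply strictAntiOn_of_hasDerivWithinAt_neg (convex_Ici 0) huc.continuousOn
      (fun s _ => (hu s).hasDerivWithinAt)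
    intro s hs
    rw [interior_Ici] at hs
    exact neg_lt_zero.2 (hqpos s hs)
  have hule : ∀ r, 0 ≤ r → u r ≤ ℓ := by
    intro r hr
    have := hanti.antitoneOn (Set.mem_Ici.2 le_rfl) (Set.mem_Ici.2 hr) hr
    rwa [hu0] at this
  have hgu : ∀ r, 0 ≤ r → 0 ≤ u r → g (u r) = u r ^ p := by
    intro r hr h
    simp only [hg, min_eq_left (hule r hr), max_eq_right h]
  have hupos : ∀ r, 0 ≤ r → 0 < u r := by
    by_contra! hcon
    obtain ⟨r, hr, hur⟩ := hcon
    obtain ⟨R, hRm, hR⟩ := intermediate_value_Icc' hr huc.continuousOn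
      (show (0:ℝ) ∈ Set.Icc (u r) (u 0) from ⟨hur, by rw [hu0]; exact hℓ.le⟩)
    have hR0 : 0 < R := by
      rcases hRm.1.eq_or_lt with h | h
      · rw [← h, hu0] at hR; linarith
      · exact h
    have hlt : ∀ x ∈ Set.Ioo 0 R, 0 < u x := by
      intro x hx
      have := hanti (Set.mem_Ici.2 hx.1.le) (Set.mem_Ici.2 hR0.le) hx.2
      rwa [hR] at this
    refine pohozaev n hp1 hp hφ hmono hpos h0 hR0 hqc (hqpos R hR0) hu hn ?_ hlt hR
    intro x hx
    rw [← hgu x hx.1.le (hlt x hx).le]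
    exact hqd x hx.1
  have hdu : deriv u = fun r => -q r := funext fun r => (hu r).deriv
  -- behaviour at the origin
  have hφlim : Filter.Tendsto (fun r => r * φ' r / φ r) (nhdsWithin 0 (Set.Ioi 0)) (nhds 1) := by
    have h1 : Filter.Tendsto (fun r => r⁻¹ * φ r) (nhdsWithin 0 (Set.Ioi 0)) (nhds (φ' 0)) := by
      have := (hφ 0).tendsto_slope_zero_right
      simpa [h0] using this
    have h2 : Filter.Tendsto φ' (nhdsWithin 0 (Set.Ioi 0)) (nhds (φ' 0)) :=
      hφ'c.continuousAt.tendsto.mono_left nhdsWithin_le_nhds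
    have h3 := h2.div h1 hφ'0.ne'
    rw [div_self hφ'0.ne'] at h3
    refine h3.congr' ?_
    filter_upwards [self_mem_nhdsWithin] with r hr
    have hr' : (0:ℝ) < r := hr
    have := hpos r hr'
    simp only [Pi.div_apply]
    field_simp
  have hgl : Filter.Tendsto (fun r => g (u r)) (nhdsWithin 0 (Set.Ioi 0)) (nhds (ℓ ^ p)) := by
    have h1 : g (u 0) = ℓ ^ p := by rw [hgu 0 le_rfl (hupos 0 le_rfl).le, hu0]
    rw [← h1]
    exact hguc.continuousAt.tendsto.mono_left nhdsWithin_le_nhds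
  have hn1 : (1 + n : ℝ) ≠ 0 := by positivity
  have hI : ∀ s, HasDerivAt (fun s => ∫ t in (0:ℝ)..s, A t * g (u t)) (A s * g (u s)) s := fun s =>
    intervalIntegral.integral_hasDerivAt_right ((hAc.mul hguc).intervalIntegrable _ _)
      (hAc.mul hguc).stronglyMeasurable.stronglyMeasurableAtFilter (hAc.mul hguc).continuousAt
  have hqr : Filter.Tendsto (fun r => q r / r) (nhdsWithin 0 (Set.Ioi 0))
      (nhds (ℓ ^ p / (1 + n))) := by
    have key := HasDerivAt.lhopital_zero_nhdsGT (a := 0)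
      (f := fun s => ∫ t in (0:ℝ)..s, A t * g (u t)) (f' := fun s => A s * g (u s))
      (g := fun s => s * A s) (g' := fun s => A s * (1 + n * (s * φ' s / φ s)))
      (l := nhds (ℓ ^ p / (1 + n))) ?_ ?_ ?_ ?_ ?_ ?_
    · refine key.congr' ?_
      filter_upwards [self_mem_nhdsWithin] with r hr
      have hr' : (0:ℝ) < r := hr
      simp only [hqdef, max_eq_left hr'.le, QQ]
      rw [div_div, mul_comm r]
    · exact Filter.Eventually.of_forall fun x => hI x
    · filter_upwards [self_mem_nhdsWithin] with r hr
      have := hpos r hr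
      refine ((hasDerivAt_id r).mul (hAd r hr)).congr_deriv ?_
      simp only [id]
      ring
    · filter_upwards [self_mem_nhdsWithin] with r hr
      have hr' : (0:ℝ) < r := hr
      have h1 := hpos r hr
      have h2 := hApos r hr
      have h3 := hφ'pos r hr'.le
      positivity
    · have := (hI 0).continuousAt.tendsto.mono_left (nhdsWithin_le_nhds (s := Set.Ioi (0:ℝ)))
      simpa using this
    · have : Continuous (fun s => s * A s) := by fun_prop
      have := this.continuousAt.tendsto.mono_left (nhdsWithin_le_nhds (a := 0) (s := Set.Ioi (0:ℝ)))
      simpa using this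
    · have h1 := hgl.div ((hφlim.const_mul (n:ℝ)).const_add 1) (by simpa using hn1)
      rw [mul_one] at h1
      refine h1.congr' ?_
      filter_upwards [self_mem_nhdsWithin] with r hr
      have h2 := hApos r hr
      simp only [Pi.div_apply]
      rw [mul_div_mul_left _ _ h2.ne']
  have hq'lim : Filter.Tendsto (fun r => g (u r) - n * φ' r / φ r * q r)
      (nhdsWithin 0 (Set.Ioi 0)) (nhds (ℓ ^ p / (1 + n))) := by
    have h1 := hgl.sub ((hφlim.const_mul (n:ℝ)).mul hqr)
    have e : ℓ ^ p - n * 1 * (ℓ ^ p / (1 + n)) = ℓ ^ p / (1 + n) := by field_simp; ring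
    rw [e] at h1
    refine h1.congr' ?_
    filter_upwards [self_mem_nhdsWithin] with r hr
    have hr' : (0:ℝ) < r := hr
    have := hpos r hr'
    field_simp
  let D : ℝ → ℝ := fun r => if r ≤ 0 then ℓ ^ p / (1 + n) else g (u r) - n * φ' r / φ r * q r
  have hqD : ∀ r ∈ Set.Ici (0:ℝ), HasDerivWithinAt q (D r) (Set.Ici 0) r := by
    intro r hr
    rcases (Set.mem_Ici.1 hr).eq_or_lt with h | h
    · subst h
      simp only [D, le_refl, if_true]
      apply hasDerivWithinAt_Ici_of_tendsto_deriv (s := Set.Ioi 0)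
      · intro x hx
        exact (hqd x hx).differentiableAt.differentiableWithinAt
      · exact hqc.continuousAt.continuousWithinAt
      · exact self_mem_nhdsWithin
      · refine hq'lim.congr' ?_
        filter_upwards [self_mem_nhdsWithin] with x hx
        exact (hqd x hx).deriv.symm
    · simp only [D, not_le.2 h, if_false]
      exact (hqd r h).hasDerivWithinAt
  have hDc : ContinuousOn D (Set.Ici 0) := by
    intro r hr
    rcases (Set.mem_Ici.1 hr).eq_or_lt with h | h
    · subst h
      rw [← continuousWithinAt_Ioi_iff_Ici]
      have : D 0 = ℓ ^ p / (1 + n) := by simp [D]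
      rw [ContinuousWithinAt, this]
      refine hq'lim.congr' ?_
      filter_upwards [self_mem_nhdsWithin] with x hx
      simp only [D, not_le.2 (Set.mem_Ioi.1 hx), if_false]
    · apply ContinuousAt.continuousWithinAt
      have h1 : ContinuousAt (fun r => g (u r) - n * φ' r / φ r * q r) r := by
        have := (hpos r h).ne'
        refine hguc.continuousAt.sub (((continuousAt_const.mul hφ'c.continuousAt).div
          hc.continuousAt this).mul hqc.continuousAt)
      refine h1.congr ?_
      filter_upwards [Ioi_mem_nhds h] with x hx
      simp only [D, not_le.2 (Set.mem_Ioi.1 hx), if_false]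
  have hud : Set.EqOn (derivWithin u (Set.Ici 0)) (fun r => -q r) (Set.Ici 0) := fun r hr =>
    (hu r).hasDerivWithinAt.derivWithin (uniqueDiffOn_Ici 0 r hr)
  have hqC : ContDiffOn ℝ 1 q (Set.Ici 0) := by
    rw [show (1 : WithTop ℕ∞) = 0 + 1 by simp, contDiffOn_succ_iff_derivWithin (uniqueDiffOn_Ici 0)]
    refine ⟨fun r hr => (hqD r hr).differentiableWithinAt, by simp, ?_⟩
    rw [contDiffOn_zero]
    exact hDc.congr fun r hr => (hqD r hr).derivWithin (uniqueDiffOn_Ici 0 r hr)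
  refine ⟨u, ?_, hupos, hu0, ?_, ?_, ?_⟩
  · rw [show (2 : WithTop ℕ∞) = 1 + 1 by norm_num,
      contDiffOn_succ_iff_derivWithin (uniqueDiffOn_Ici 0)]
    refine ⟨fun r hr => (hu r).differentiableAt.differentiableWithinAt, by simp, ?_⟩
    exact hqC.neg.congr hud
  · rw [hud (Set.mem_Ici.2 le_rfl)]; simp [hq0]
  · intro r hr
    rw [hdu]
    exact neg_lt_zero.2 (hqpos r hr)
  · intro r hr
    have h1 : deriv (deriv u) r = -(g (u r) - n * φ' r / φ r * q r) := by
      rw [hdu]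
      exact (hqd r hr).neg.deriv
    rw [h1, hdu, hgu r hr.le (hupos r hr.le).le]
    ring

/-- Global existence of positive radial solutions (analytic core of Theorem 1.2):
under conditions (a) and (b), the radial weighted Lane-Emden ODE has a global
positive strictly decreasing solution with u(0) = ℓ, u'(0) = 0. -/
theorem global_positive_radial_solution
    (d : ℕ) (hd : 3 ≤ d) (p : ℝ) (hp : ((d : ℝ) + 2) / ((d : ℝ) - 2) ≤ p)
    (ℓ : ℝ) (hℓ : 0 < ℓ)
    (ψ f : ℝ → ℝ) (hψ : ContDiff ℝ (⊤ : ℕ∞) ψ) (hψ0 : ψ 0 = 0)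
    (hψ'0 : deriv ψ 0 = 1) (hψ' : ∀ r : ℝ, 0 < r → 0 < deriv ψ r)
    (hf : ContDiff ℝ (⊤ : ℕ∞) f) (hf'0 : deriv f 0 = 0)
    (ha : ∀ r : ℝ, 0 < r → deriv f r < ((d : ℝ) - 1) * deriv ψ r / ψ r)
    (hb : ∀ r : ℝ, 0 < r →
        -((d : ℝ) - 1) * deriv (deriv ψ) r / ψ r + deriv (deriv f) r
          + 2 * deriv ψ r * deriv f r / ψ r - deriv f r ^ 2 / ((d : ℝ) - 1) ≤ 0) :
    ∃ u : ℝ → ℝ, ContDiffOn ℝ 2 u (Set.Ici 0) ∧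
      (∀ r : ℝ, 0 ≤ r → 0 < u r) ∧
      u 0 = ℓ ∧
      derivWithin u (Set.Ici 0) 0 = 0 ∧
      (∀ r : ℝ, 0 < r → deriv u r < 0) ∧
      (∀ r : ℝ, 0 < r →
        deriv (deriv u) r
          + (((d : ℝ) - 1) * deriv ψ r / ψ r - deriv f r) * deriv u r + u r ^ p = 0) := by
  have hd3 : (3:ℝ) ≤ d := by exact_mod_cast hd
  obtain ⟨n, rfl⟩ : ∃ n, d = n + 1 := ⟨d - 1, by omega⟩
  have hn : n ≠ 0 := by omega
  push_cast at *
  have hn2 : (2:ℝ) ≤ n := by linarith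
  have hn0 : (n:ℝ) ≠ 0 := by positivity
  have e1 : (n:ℝ) + 1 - 1 = n := by ring
  simp only [e1] at *
  have hp2 : (n:ℝ) + 1 + 2 ≤ p * (n + 1 - 2) := (div_le_iff₀ (by linarith)).1 hp
  have hp1 : 1 < p := by nlinarith
  have hpp : 1 / (p + 1) + 1 / 2 ≤ (n : ℝ) / (n + 1) := by
    rw [div_add_div _ _ (by linarith) (by norm_num), div_le_div_iff₀ (by linarith) (by linarith)]
    nlinarith
  have hψd : ∀ r, HasDerivAt ψ (deriv ψ r) r := fun r =>
    (hψ.differentiable (by simp) r).hasDerivAt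
  have hfd : ∀ r, HasDerivAt f (deriv f r) r := fun r =>
    (hf.differentiable (by simp) r).hasDerivAt
  have hψ1 : ContDiff ℝ (⊤ : ℕ∞) (deriv ψ) := (contDiff_infty_iff_deriv.1 hψ).2
  have hf1 : ContDiff ℝ (⊤ : ℕ∞) (deriv f) := (contDiff_infty_iff_deriv.1 hf).2
  have hψdd : ∀ r, HasDerivAt (deriv ψ) (deriv (deriv ψ) r) r := fun r =>
    (hψ1.differentiable (by simp) r).hasDerivAt
  have hfdd : ∀ r, HasDerivAt (deriv f) (deriv (deriv f) r) r := fun r =>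
    (hf1.differentiable (by simp) r).hasDerivAt
  have hψpos : ∀ r, 0 < r → 0 < ψ r := by
    intro r hr
    have hsm : StrictMonoOn ψ (Set.Ici 0) := by
      apply strictMonoOn_of_deriv_pos (convex_Ici 0) hψ.continuous.continuousOn
      intro s hs
      rw [interior_Ici] at hs
      exact hψ' s hs
    have := hsm (Set.mem_Ici.2 le_rfl) (Set.mem_Ici.2 hr.le) hr
    rwa [hψ0] at this
  let E : ℝ → ℝ := fun r => exp (-f r / n)
  have hE : ∀ r, HasDerivAt E (E r * (-deriv f r / n)) r := fun r =>
    ((hfd r).neg.div_const (n:ℝ)).exp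
  let φ : ℝ → ℝ := fun r => ψ r * E r
  let φ' : ℝ → ℝ := fun r => (deriv ψ r - ψ r * deriv f r / n) * E r
  have hφ : ∀ r, HasDerivAt φ (φ' r) r := by
    intro r
    refine ((hψd r).mul (hE r)).congr_deriv ?_
    simp only [φ']
    ring
  have hφ' : ∀ r, HasDerivAt φ' ((deriv (deriv ψ) r - 2 * deriv ψ r * deriv f r / n
      - ψ r * deriv (deriv f) r / n + ψ r * deriv f r ^ 2 / n ^ 2) * E r) r := by
    intro r
    refine (((hψdd r).sub (((hψd r).mul (hfdd r)).div_const (n:ℝ))).mul (hE r)).congr_deriv ?_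
    simp only [Pi.sub_apply, Pi.mul_apply]
    field_simp
    ring
  have hφ'c : Continuous φ' := continuous_iff_continuousAt.2 fun r => (hφ' r).continuousAt
  have hmono : MonotoneOn φ' (Set.Ici 0) := by
    apply monotoneOn_of_hasDerivWithinAt_nonneg (convex_Ici 0) hφ'c.continuousOn
      (fun s _ => (hφ' s).hasDerivWithinAt)
    intro r hr
    rw [interior_Ici] at hr
    have h1 := hψpos r hr
    have h2 := hb r hr
    refine mul_nonneg ?_ (exp_pos _).le
    have e : deriv (deriv ψ) r - 2 * deriv ψ r * deriv f r / n
      - ψ r * deriv (deriv f) r / n + ψ r * deriv f r ^ 2 / n ^ 2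
      = (-(-(n:ℝ) * deriv (deriv ψ) r / ψ r + deriv (deriv f) r
          + 2 * deriv ψ r * deriv f r / ψ r - deriv f r ^ 2 / (n:ℝ))) * (ψ r / n) := by
      field_simp
      ring
    rw [e]
    exact mul_nonneg (by linarith) (by positivity)
  have hφ'0 : 0 < φ' 0 := by
    simp only [φ', hψ'0, hψ0, zero_mul, zero_div, sub_zero, one_mul]
    exact exp_pos _
  obtain ⟨u, h1, h2, h3, h4, h5, h6⟩ := core n hn hp1 hpp hℓ hφ hφ'c hmono hφ'0
    (by simp [φ, hψ0])
  refine ⟨u, h1, h2, h3, h4, h5, fun r hr => ?_⟩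
  rw [← h6 r hr]
  have e : (n:ℝ) * deriv ψ r / ψ r - deriv f r = n * φ' r / φ r := by
    have := hψpos r hr
    have hEr : 0 < E r := exp_pos _
    simp only [φ, φ']
    field_simp
  rw [e]
end

section
/- (Positivity of the angular curvature component.) Let d ≥ 3 be an integer. Let ψ : [0,∞) → ℝ be C² with ψ(0) = 0, ψ'(0) = 1, ψ'(r) > 0 and ψ''(r) < 0 for all r > 0, and let f : [0,∞) → ℝ be C² with f'(r) < 0 for all r > 0, satisfying the relation f''(r) + 2(ψ'(r)/ψ(r))·f'(r) = (d−1)·ψ''(r)/ψ(r) for all r > 0. Define Ψ(r) = (d−2)·(1 − ψ'(r)²) + ψ(r)·ψ'(r)·f'(r). Then Ψ'(r) = −(d−3)ψ'(r)ψ''(r) − ψ'(r)²f'(r) + ψ''(r)ψ(r)f'(r) > 0 for all r > 0, and consequently Ψ(r) > 0 for all r > 0. -/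
open Real

/-- Positivity of the angular curvature component: for the constructed pair (ψ, f),
Ψ = (d−2)(1−(ψ')²) + ψψ'f' has positive derivative, hence Ψ > 0 on (0,∞). -/
theorem angular_curvature_positive
    (d : ℕ) (hd : 3 ≤ d)
    (ψ f : ℝ → ℝ) (hψ : ContDiff ℝ 2 ψ) (hψ0 : ψ 0 = 0) (hψ'0 : deriv ψ 0 = 1)
    (hψ' : ∀ r : ℝ, 0 < r → 0 < deriv ψ r)
    (hψ'' : ∀ r : ℝ, 0 < r → deriv (deriv ψ) r < 0)
    (hf : ContDiff ℝ 2 f) (hf' : ∀ r : ℝ, 0 < r → deriv f r < 0)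
    (hrel : ∀ r : ℝ, 0 < r →
        deriv (deriv f) r + 2 * (deriv ψ r / ψ r) * deriv f r
          = ((d : ℝ) - 1) * deriv (deriv ψ) r / ψ r)
    (Ψ : ℝ → ℝ)
    (hΨ : ∀ r, Ψ r = ((d : ℝ) - 2) * (1 - deriv ψ r ^ 2) + ψ r * deriv ψ r * deriv f r) :
    ∀ r : ℝ, 0 < r →
      (deriv Ψ r = -((d : ℝ) - 3) * deriv ψ r * deriv (deriv ψ) r
            - deriv ψ r ^ 2 * deriv f r + deriv (deriv ψ) r * ψ r * deriv f r
        ∧ 0 < deriv Ψ r)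
      ∧ 0 < Ψ r := by
  have hdR : (3 : ℝ) ≤ d := by exact_mod_cast hd
  have dψ : Differentiable ℝ ψ := hψ.differentiable (by norm_num)
  have dψ' : Differentiable ℝ (deriv ψ) :=
    ((contDiff_succ_iff_deriv (n := 1)).1 hψ).2.2.differentiable (by norm_num)
  have df' : Differentiable ℝ (deriv f) :=
    ((contDiff_succ_iff_deriv (n := 1)).1 hf).2.2.differentiable (by norm_num)
  have hmono : StrictMonoOn ψ (Set.Ici 0) := by
    apply strictMonoOn_of_deriv_pos (convex_Ici 0) dψ.continuous.continuousOn
    intro x hx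
    rw [interior_Ici] at hx
    exact hψ' x hx
  have hpos : ∀ r : ℝ, 0 < r → 0 < ψ r := by
    intro r hr
    have := hmono (Set.mem_Ici.2 le_rfl) (Set.mem_Ici.2 hr.le) hr
    rwa [hψ0] at this
  have hD : ∀ r : ℝ, HasDerivAt Ψ (((d : ℝ) - 2) * (-(2 * deriv ψ r * deriv (deriv ψ) r))
      + ((deriv ψ r * deriv ψ r + ψ r * deriv (deriv ψ) r) * deriv f r
        + ψ r * deriv ψ r * deriv (deriv f) r)) r := by
    intro r
    have h1 := (dψ r).hasDerivAt
    have h2 := (dψ' r).hasDerivAt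
    have h3 := (df' r).hasDerivAt
    have e : Ψ = fun r => ((d : ℝ) - 2) * (1 - deriv ψ r ^ 2) + ψ r * deriv ψ r * deriv f r :=
      funext hΨ
    rw [e]
    have := (((h2.pow 2).const_sub 1).const_mul ((d : ℝ) - 2)).add ((h1.mul h2).mul h3)
    refine this.congr_deriv ?_
    simp
  have hform : ∀ r : ℝ, 0 < r → deriv Ψ r = -((d : ℝ) - 3) * deriv ψ r * deriv (deriv ψ) r
            - deriv ψ r ^ 2 * deriv f r + deriv (deriv ψ) r * ψ r * deriv f r := by
    intro r hr
    rw [(hD r).deriv]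
    have hp := (hpos r hr).ne'
    have h := hrel r hr
    field_simp at h
    linear_combination deriv ψ r * h
  have hdpos : ∀ r : ℝ, 0 < r → 0 < deriv Ψ r := by
    intro r hr
    rw [hform r hr]
    have a := hψ' r hr
    have b := hψ'' r hr
    have c := hf' r hr
    have p := hpos r hr
    have t1 : 0 ≤ ((d : ℝ) - 3) * (deriv ψ r * -deriv (deriv ψ) r) :=
      mul_nonneg (by linarith) (mul_nonneg a.le (by linarith))
    have t2 : 0 < deriv ψ r ^ 2 * -deriv f r := mul_pos (by positivity) (by linarith)
    have t3 : 0 < ψ r * (deriv (deriv ψ) r * deriv f r) := mul_pos p (mul_pos_of_neg_of_neg b c)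
    linarith
  have hΨmono : StrictMonoOn Ψ (Set.Ici 0) := by
    apply strictMonoOn_of_deriv_pos (convex_Ici 0)
      (fun x _ => (hD x).continuousAt.continuousWithinAt)
    intro x hx
    rw [interior_Ici] at hx
    exact hdpos x hx
  intro r hr
  refine ⟨⟨hform r hr, hdpos r hr⟩, ?_⟩
  have := hΨmono (Set.mem_Ici.2 le_rfl) (Set.mem_Ici.2 hr.le) hr
  have h0 : Ψ 0 = 0 := by rw [hΨ, hψ0, hψ'0]; ring
  rwa [h0] at this
end

section
/- (Failure of sharp Laplacian comparison but validity of the rough bound for the constructed model.) Let d ≥ 3 be an integer and α ∈ (0,1). Let ψ : [0,∞) → ℝ be C² with ψ(0) = 0, ψ'(0) = 1, ψ'(r) > 0 and ψ''(r) < 0 for all r > 0, and suppose α·r ≤ ψ(r) ≤ r for all r ≥ 0. Define f' by f'(r) = (d−1)·ψ(r)^{−2}·∫₀^r ψ''(s)ψ(s) ds for r > 0. Then for every r > 0: (i) the radial weighted Laplacian of the distance satisfies the identity (d−1)·ψ'(r)/ψ(r) − f'(r) = (d−1)·ψ(r)^{−2}·∫₀^r ψ'(s)² ds; (ii) ∫₀^r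 ψ'(s)² ds > ψ(r)²/r, so that (d−1)ψ'(r)/ψ(r) − f'(r) > (d−1)/r (sharp Laplacian comparison fails); (iii) (d−1)ψ'(r)/ψ(r) − f'(r) ≤ (d−1)/(α²·r) (the rough comparison holds). -/
open Real

/-- For the constructed model: the sharp Laplacian comparison 𝓛r ≤ (d−1)/r fails,
but the rough comparison 𝓛r ≤ (d−1)/(α²r) holds, where
𝓛r = (d−1)ψ'/ψ − f' and f' is given by the explicit integral formula. -/
theorem laplacian_comparison_fails_rough_holds
    (d : ℕ) (hd : 3 ≤ d) (α : ℝ) (hα0 : 0 < α) (hα1 : α < 1)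
    (ψ : ℝ → ℝ) (hψ : ContDiff ℝ 2 ψ) (hψ0 : ψ 0 = 0) (hψ'0 : deriv ψ 0 = 1)
    (hψ' : ∀ r : ℝ, 0 < r → 0 < deriv ψ r)
    (hψ'' : ∀ r : ℝ, 0 < r → deriv (deriv ψ) r < 0)
    (hbound : ∀ r : ℝ, 0 ≤ r → α * r ≤ ψ r ∧ ψ r ≤ r)
    (f' : ℝ → ℝ)
    (hf' : ∀ r : ℝ, 0 < r →
        f' r = ((d : ℝ) - 1) * (∫ s in (0:ℝ)..r, deriv (deriv ψ) s * ψ s) / ψ r ^ 2) :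
    ∀ r : ℝ, 0 < r →
      (((d : ℝ) - 1) * deriv ψ r / ψ r - f' r
          = ((d : ℝ) - 1) * (∫ s in (0:ℝ)..r, deriv ψ s ^ 2) / ψ r ^ 2) ∧
      (ψ r ^ 2 / r < ∫ s in (0:ℝ)..r, deriv ψ s ^ 2) ∧
      (((d : ℝ) - 1) / r < ((d : ℝ) - 1) * deriv ψ r / ψ r - f' r) ∧
      (((d : ℝ) - 1) * deriv ψ r / ψ r - f' r ≤ ((d : ℝ) - 1) / (α ^ 2 * r)) := by
  intro r hr
  have hd1 : (0:ℝ) < (d : ℝ) - 1 := by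
    have : (3:ℝ) ≤ d := by exact_mod_cast hd
    linarith
  have h1 : ContDiff ℝ 1 (deriv ψ) := by
    have h : ContDiff ℝ (1 + 1) ψ := by
      have e : (1 + 1 : WithTop ℕ∞) = 2 := by norm_num
      rw [e]; exact hψ
    exact (contDiff_succ_iff_deriv.1 h).2.2
  have hc0 : Continuous ψ := hψ.continuous
  have hc1 : Continuous (deriv ψ) := h1.continuous
  have hc2 : Continuous (deriv (deriv ψ)) := h1.continuous_deriv le_rfl
  have hD0 : ∀ x, HasDerivAt ψ (deriv ψ x) x := fun x =>
    (hψ.differentiable (by norm_num) x).hasDerivAt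
  have hD1 : ∀ x, HasDerivAt (deriv ψ) (deriv (deriv ψ) x) x := fun x =>
    (h1.differentiable (by norm_num) x).hasDerivAt
  have hanti : StrictAntiOn (deriv ψ) (Set.Ici 0) := by
    apply strictAntiOn_of_deriv_neg (convex_Ici 0) hc1.continuousOn
    intro x hx
    rw [interior_Ici] at hx
    exact hψ'' x hx
  have hψr : 0 < ψ r := lt_of_lt_of_le (mul_pos hα0 hr) (hbound r hr.le).1
  have hparts : (∫ s in (0:ℝ)..r, deriv (deriv ψ) s * ψ s) + (∫ s in (0:ℝ)..r, deriv ψ s ^ 2)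
      = deriv ψ r * ψ r := by
    have i1 : IntervalIntegrable (fun s => deriv (deriv ψ) s * ψ s) MeasureTheory.volume 0 r :=
      (hc2.mul hc0).intervalIntegrable _ _
    have i2 : IntervalIntegrable (fun s => deriv ψ s ^ 2) MeasureTheory.volume 0 r :=
      (hc1.pow 2).intervalIntegrable _ _
    rw [← intervalIntegral.integral_add i1 i2]
    rw [intervalIntegral.integral_eq_sub_of_hasDerivAt (f := fun s => deriv ψ s * ψ s)]
    · simp [hψ0]
    · intro x _
      have := (hD1 x).mul (hD0 x)
      rw [pow_two]
      exact this
    · exact ((hc2.mul hc0).add (hc1.pow 2)).intervalIntegrable _ _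
  have hint : (∫ s in (0:ℝ)..r, deriv ψ s) = ψ r := by
    rw [intervalIntegral.integral_eq_sub_of_hasDerivAt (fun x _ => hD0 x)
      (hc1.intervalIntegrable _ _), hψ0, sub_zero]
  have hI : ((d : ℝ) - 1) * deriv ψ r / ψ r - f' r
          = ((d : ℝ) - 1) * (∫ s in (0:ℝ)..r, deriv ψ s ^ 2) / ψ r ^ 2 := by
    rw [hf' r hr, eq_sub_of_add_eq hparts]
    field_simp
    ring
  have hpos : 0 < ∫ s in (0:ℝ)..r, (deriv ψ s - ψ r / r) ^ 2 := by
    apply intervalIntegral.integral_pos hr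
    · exact ((hc1.sub continuous_const).pow 2).continuousOn
    · intro x _
      positivity
    · have hlt : deriv ψ r < deriv ψ 0 := hanti (Set.mem_Ici.2 le_rfl) (Set.mem_Ici.2 hr.le) hr
      by_cases h : deriv ψ 0 = ψ r / r
      · exact ⟨r, ⟨hr.le, le_rfl⟩, sq_pos_of_ne_zero (by linarith : deriv ψ r - ψ r / r < 0).ne⟩
      · exact ⟨0, ⟨le_rfl, hr.le⟩, sq_pos_of_ne_zero (sub_ne_zero.2 h)⟩
  have hexp : (∫ s in (0:ℝ)..r, (deriv ψ s - ψ r / r) ^ 2)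
      = (∫ s in (0:ℝ)..r, deriv ψ s ^ 2) - ψ r ^ 2 / r := by
    have e : ∀ s, (deriv ψ s - ψ r / r) ^ 2
        = deriv ψ s ^ 2 - (2 * (ψ r / r)) * deriv ψ s + (ψ r / r) ^ 2 := fun s => by ring
    simp_rw [e]
    have i2 : IntervalIntegrable (fun s => deriv ψ s ^ 2) MeasureTheory.volume 0 r :=
      (hc1.pow 2).intervalIntegrable _ _
    have i3 : IntervalIntegrable (fun s => (2 * (ψ r / r)) * deriv ψ s)
        MeasureTheory.volume 0 r :=
      (continuous_const.mul hc1).intervalIntegrable _ _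
    have i4 : IntervalIntegrable (fun s => deriv ψ s ^ 2 - (2 * (ψ r / r)) * deriv ψ s)
        MeasureTheory.volume 0 r := i2.sub i3
    rw [intervalIntegral.integral_add i4 (continuous_const.intervalIntegrable _ _),
      intervalIntegral.integral_sub i2 i3,
      intervalIntegral.integral_const_mul, hint, intervalIntegral.integral_const, smul_eq_mul]
    field_simp
    ring
  have hII : ψ r ^ 2 / r < ∫ s in (0:ℝ)..r, deriv ψ s ^ 2 := by linarith
  have hle : (∫ s in (0:ℝ)..r, deriv ψ s ^ 2) ≤ r := by
    have := intervalIntegral.integral_mono_on hr.le ((hc1.pow 2).intervalIntegrable 0 r)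
      (continuous_const.intervalIntegrable (μ := MeasureTheory.volume) (u := fun _ : ℝ => (1:ℝ)) 0 r)
      (fun x hx => by
        have ha : deriv ψ x ≤ 1 := hψ'0 ▸
          hanti.antitoneOn (Set.mem_Ici.2 le_rfl) (Set.mem_Ici.2 hx.1) hx.1
        have hb : 0 ≤ deriv ψ x := by
          rcases hx.1.eq_or_lt with h | h
          · rw [← h, hψ'0]; norm_num
          · exact (hψ' x h).le
        exact pow_le_one₀ hb ha)
    simpa using this
  refine ⟨hI, hII, ?_, ?_⟩
  · rw [hI, lt_div_iff₀ (by positivity)]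
    calc ((d : ℝ) - 1) / r * ψ r ^ 2 = ((d : ℝ) - 1) * (ψ r ^ 2 / r) := by ring
      _ < _ := mul_lt_mul_of_pos_left hII hd1
  · rw [hI, div_le_div_iff₀ (by positivity) (by positivity), mul_assoc]
    apply mul_le_mul_of_nonneg_left _ hd1.le
    calc _ ≤ r * (α ^ 2 * r) := mul_le_mul_of_nonneg_right hle (by positivity)
      _ = (α * r) ^ 2 := by ring
      _ ≤ ψ r ^ 2 := pow_le_pow_left₀ (by positivity) (hbound r hr.le).1 2
end

section
/- (Decay estimate, property 7 of Theorem 1.2.) Fix an integer d ≥ 3, reals p > 1, ℓ > 0, α ∈ (0,1), and constants 0 < C₁ < C₂. Let ψ : [0,∞) → ℝ be smooth with α·r ≤ ψ(r) ≤ r for all r ≥ 0, and let f : [0,∞) → ℝ be smooth with C₁ ≤ e^{−f(r)} ≤ C₂ for all r ≥ 0; set w(r) = e^{−f(r)}ψ(r)^{d−1}. Let u ∈ C²([0,∞)) be positive with u(0) = ℓ, u'(0) = 0, satisfying u''(r) + ((d−1)ψ'(r)/ψ(r) − f'(r))u'(r) + u(r)^p = 0 for all r > 0, and assume that the Pohozaev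 function P_u(r) = (∫₀^r w)·(u'(r)²/2 + u(r)^{p+1}/(p+1)) + (1/(p+1))·w(r)u(r)u'(r) satisfies P_u(r) ≤ 0 for all r > 0. Then u(r) ≤ (C·r² + ℓ^{1−p})^{−1/(p−1)} for all r > 0, where C = ((p−1)/(2d))·(C₁/C₂)·α^{d−1}. -/
open Real

/-- Decay estimate (property 7 of Theorem 1.2): if the Pohozaev function is
nonpositive, then u(r) ≤ (C r² + ℓ^{1−p})^{−1/(p−1)} with
C = ((p−1)/(2d))(C₁/C₂)α^{d−1}. -/
theorem radial_solution_decay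
    (d : ℕ) (hd : 3 ≤ d) (p ℓ α C₁ C₂ : ℝ)
    (hp : 1 < p) (hℓ : 0 < ℓ) (hα0 : 0 < α) (hα1 : α < 1)
    (hC1 : 0 < C₁) (hC12 : C₁ < C₂)
    (ψ f : ℝ → ℝ) (hψ : ContDiff ℝ (⊤ : ℕ∞) ψ)
    (hψb : ∀ r : ℝ, 0 ≤ r → α * r ≤ ψ r ∧ ψ r ≤ r)
    (hf : ContDiff ℝ (⊤ : ℕ∞) f)
    (hfb : ∀ r : ℝ, 0 ≤ r → C₁ ≤ Real.exp (-f r) ∧ Real.exp (-f r) ≤ C₂)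
    (w : ℝ → ℝ) (hw : ∀ r, w r = Real.exp (-f r) * ψ r ^ (d - 1))
    (u : ℝ → ℝ) (hu : ContDiffOn ℝ 2 u (Set.Ici 0))
    (hupos : ∀ r : ℝ, 0 ≤ r → 0 < u r) (hu0 : u 0 = ℓ)
    (hu'0 : derivWithin u (Set.Ici 0) 0 = 0)
    (hode : ∀ r : ℝ, 0 < r →
        deriv (deriv u) r
          + (((d : ℝ) - 1) * deriv ψ r / ψ r - deriv f r) * deriv u r + u r ^ p = 0)
    (hPu : ∀ r : ℝ, 0 < r →
        (∫ s in (0:ℝ)..r, w s) * (deriv u r ^ 2 / 2 + u r ^ (p + 1) / (p + 1))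
          + (1 / (p + 1)) * w r * u r * deriv u r ≤ 0) :
    ∀ r : ℝ, 0 < r →
      u r ≤ (((p - 1) / (2 * d)) * (C₁ / C₂) * α ^ (d - 1) * r ^ 2
          + ℓ ^ (1 - p)) ^ (-(1 / (p - 1))) := by
  have hC2 : 0 < C₂ := hC1.trans hC12
  have hd1 : 1 ≤ d := by omega
  have hdpos : (0:ℝ) < d := by exact_mod_cast hd1
  have hwc : Continuous w := by
    have : w = fun r => Real.exp (-f r) * ψ r ^ (d - 1) := funext hw
    rw [this]
    have h1 := hψ.continuous
    have h2 := hf.continuous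
    fun_prop
  have hW : ∀ r : ℝ, 0 < r → C₁ * α ^ (d - 1) * (r ^ d / d) ≤ ∫ s in (0:ℝ)..r, w s := by
    intro r hr
    have h1 : (∫ s in (0:ℝ)..r, C₁ * α ^ (d - 1) * s ^ (d - 1))
        = C₁ * α ^ (d - 1) * (r ^ d / d) := by
      rw [intervalIntegral.integral_const_mul, integral_pow]
      have h2 : d - 1 + 1 = d := by omega
      have h3 : ((d - 1 : ℕ) : ℝ) + 1 = d := by exact_mod_cast h2
      rw [h2, h3, zero_pow (by omega), sub_zero]
    rw [← h1]
    apply intervalIntegral.integral_mono_on hr.le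
    · apply Continuous.intervalIntegrable; fun_prop
    · exact hwc.intervalIntegrable _ _
    · intro s hs
      rw [hw, mul_assoc, ← mul_pow]
      have h4 : 0 ≤ α * s := mul_nonneg hα0.le hs.1
      exact mul_le_mul (hfb s hs.1).1 (pow_le_pow_left₀ h4 (hψb s hs.1).1 _)
        (pow_nonneg h4 _) (Real.exp_pos _).le
  have hwle : ∀ r : ℝ, 0 < r → w r ≤ C₂ * r ^ (d - 1) := by
    intro r hr
    rw [hw]
    have h4 : 0 ≤ ψ r := (mul_nonneg hα0.le hr.le).trans (hψb r hr.le).1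
    exact mul_le_mul (hfb r hr.le).2 (pow_le_pow_left₀ h4 (hψb r hr.le).2 _)
        (pow_nonneg h4 _) hC2.le
  have hwpos : ∀ r : ℝ, 0 < r → 0 < w r := by
    intro r hr
    rw [hw]
    have h4 : 0 < ψ r := (mul_pos hα0 hr).trans_le (hψb r hr.le).1
    positivity
  have key : ∀ r : ℝ, 0 < r →
      1 / d * (C₁ / C₂) * α ^ (d - 1) * r * u r ^ p ≤ -deriv u r := by
    intro r hr
    have hu1 := hupos r hr.le
    have hup : 0 < u r ^ p := Real.rpow_pos_of_pos hu1 p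
    have hP := hPu r hr
    have hWr := hW r hr
    have hL : 0 < C₁ * α ^ (d - 1) * (r ^ d / d) := by positivity
    set W := ∫ s in (0:ℝ)..r, w s
    have hWpos : 0 < W := hL.trans_le hWr
    have hp1 : 0 < p + 1 := by linarith
    rw [Real.rpow_add_one hu1.ne'] at hP
    have e1 : W * (u r ^ p) ≤ w r * (-deriv u r) := by
      have h0 : 0 ≤ W * (deriv u r ^ 2 / 2) := by positivity
      have h1 : (u r / (p + 1)) * (W * u r ^ p - w r * (-deriv u r)) ≤ 0 := by
        calc _ = W * (deriv u r ^ 2 / 2 + u r ^ p * u r / (p + 1))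
            + (1 / (p + 1)) * w r * u r * deriv u r - W * (deriv u r ^ 2 / 2) := by ring
          _ ≤ 0 := by linarith
      have h2 : 0 < u r / (p + 1) := by positivity
      have h3 := nonpos_of_mul_nonpos_right h1 h2
      linarith
    have hv : 0 < -deriv u r := by
      have h5 : 0 < w r * (-deriv u r) := (mul_pos hWpos hup).trans_le e1
      exact (pos_iff_pos_of_mul_pos h5).1 (hwpos r hr)
    have e2 : C₁ * α ^ (d - 1) * (r ^ d / d) * u r ^ p ≤ C₂ * r ^ (d - 1) * (-deriv u r) :=
      ((mul_le_mul_of_nonneg_right hWr hup.le).trans e1).trans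
        (mul_le_mul_of_nonneg_right (hwle r hr) hv.le)
    have hrd : r ^ d = r ^ (d - 1) * r := by
      rw [← pow_succ]; congr 1; omega
    have hc : 0 < C₂ * r ^ (d - 1) := by positivity
    refine le_of_mul_le_mul_left ?_ hc
    refine le_trans (le_of_eq ?_) e2
    rw [hrd]
    field_simp
  set K : ℝ := ((p - 1) / (2 * d)) * (C₁ / C₂) * α ^ (d - 1) with hK
  have hKpos : 0 < K := by
    have : 0 < p - 1 := by linarith
    positivity
  have hmono : MonotoneOn (fun r => u r ^ (1 - p) - K * r ^ 2) (Set.Ici 0) := by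
    have hder : ∀ r : ℝ, 0 < r → HasDerivAt (fun r => u r ^ (1 - p) - K * r ^ 2)
        (deriv u r * (1 - p) * u r ^ (1 - p - 1) - K * (2 * r)) r := by
      intro r hr
      have h1 : DifferentiableAt ℝ u r :=
        (hu.differentiableOn (by norm_num)).differentiableAt (Ici_mem_nhds hr)
      have h2 := h1.hasDerivAt.rpow_const (p := 1 - p) (Or.inl (hupos r hr.le).ne')
      have h3 := ((hasDerivAt_pow 2 r).const_mul K)
      have h4 := h2.fun_sub h3
      refine h4.congr_deriv ?_
      norm_num
    apply monotoneOn_of_deriv_nonneg (convex_Ici 0)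
    · apply ContinuousOn.sub
      · exact hu.continuousOn.rpow_const (fun x hx => Or.inl (hupos x hx).ne')
      · fun_prop
    · intro r hr
      rw [interior_Ici] at hr
      exact (hder r hr).differentiableAt.differentiableWithinAt
    · intro r hr
      rw [interior_Ici] at hr
      rw [(hder r hr).deriv]
      have hu1 := hupos r (le_of_lt hr)
      have hq : 0 < u r ^ (1 - p - 1) := Real.rpow_pos_of_pos hu1 _
      have hqq : u r ^ p * u r ^ (1 - p - 1) = 1 := by
        rw [← Real.rpow_add hu1]; simp
      have h6 := mul_le_mul_of_nonneg_right (key r hr)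
        (mul_pos (by linarith : 0 < p - 1) hq).le
      have h7 : 1 / d * (C₁ / C₂) * α ^ (d - 1) * r * u r ^ p * ((p - 1) * u r ^ (1 - p - 1))
          = K * (2 * r) := by
        calc _ = 1 / d * (C₁ / C₂) * α ^ (d - 1) * r * (p - 1) *
              (u r ^ p * u r ^ (1 - p - 1)) := by ring
          _ = K * (2 * r) := by rw [hqq, hK]; field_simp
      rw [h7] at h6
      linarith
  intro r hr
  have h := hmono (Set.mem_Ici.2 le_rfl) (Set.mem_Ici.2 hr.le) hr.le
  simp only [hu0] at h
  have hu1 := hupos r hr.le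
  have hl : 0 < ℓ ^ (1 - p) := Real.rpow_pos_of_pos hℓ _
  have hbase : 0 < K * r ^ 2 + ℓ ^ (1 - p) := by positivity
  have hle : K * r ^ 2 + ℓ ^ (1 - p) ≤ u r ^ (1 - p) := by
    have : K * (0:ℝ) ^ 2 = 0 := by simp
    linarith
  have hp1 : 0 < p - 1 := by linarith
  have hexp : -(1 / (p - 1)) ≤ 0 := by
    have : 0 < 1 / (p - 1) := by positivity
    linarith
  have h8 := Real.rpow_le_rpow_of_nonpos hbase hle hexp
  rw [← Real.rpow_mul hu1.le] at h8
  have h9 : (1 - p) * -(1 / (p - 1)) = 1 := by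
    field_simp
    ring
  rwa [h9, Real.rpow_one] at h8
end
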